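/- One has ϑ(p_n)/n = log p_{n+1} · (1 − 1/log n + (log log n)/(log² n)·(1 + o(1))) as n → ∞; equivalently, the quantity (ϑ(p_n)/(n·log p_{n+1}) − 1 + 1/log n) · (log² n)/(log log n) tends to 1 as n → ∞. -/

import Mathlib

open Real

/-- The Chebyshev theta function: `ϑ(x) = ∑_{p ≤ x} log p`, the sum of the natural
logarithms of the primes not exceeding `x`. -/
noncomputable def chebyshevTheta (x : ℕ) : ℝ :=
  ∑ p ∈ (Finset.range (x + 1)).filter Nat.Prime, Real.log p

/-- `nthPrime n` is the `n`-th prime `p_n` (so `nthPrime 1 = 2`, `nthPrime 2 = 3`, ...). -/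
noncomputable def nthPrime (n : ℕ) : ℕ := Nat.nth Nat.Prime (n - 1)

/-- The entire function `(s - 1) ζ(s)`, with its value `1` at `s = 1`. -/
noncomputable def zetaPole : ℂ → ℂ :=
  Function.update (fun s => (s - 1) * riemannZeta s) 1 1

lemma zetaPole_of_ne {s : ℂ} (hs : s ≠ 1) : zetaPole s = (s - 1) * riemannZeta s :=
  Function.update_of_ne hs _ _

lemma zetaPole_one : zetaPole 1 = 1 := Function.update_self ..

lemma differentiable_zetaPole : Differentiable ℂ zetaPole := by
  rw [← differentiableOn_univ,
    ← Complex.differentiableOn_compl_singleton_and_continuousAt_iff (c := 1) Filter.univ_mem]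
  constructor
  · intro s hs
    have hs1 : s ≠ 1 := by simpa using hs
    have : DifferentiableAt ℂ (fun s => (s - 1) * riemannZeta s) s :=
      (differentiableAt_id.sub_const 1).mul (differentiableAt_riemannZeta hs1)
    refine (this.congr_of_eventuallyEq ?_).differentiableWithinAt
    filter_upwards [eventually_ne_nhds hs1] with z hz using zetaPole_of_ne hz
  · rw [zetaPole, continuousAt_update_same]
    exact riemannZeta_residue_one

lemma zetaPole_ne_zero {s : ℂ} (hs : 1 ≤ s.re) : zetaPole s ≠ 0 := by
  rcases eq_or_ne s 1 with rfl | h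
  · simp [zetaPole_one]
  · rw [zetaPole_of_ne h]
    exact mul_ne_zero (sub_ne_zero.2 h) (riemannZeta_ne_zero_of_one_le_re hs)

/-- The error of the rectangle rule for `∫ u in n..n+1, u ^ (-s)`, multiplied by `s - 1`. -/
noncomputable def rectangleError (s : ℂ) (n : ℕ) : ℂ :=
  (s - 1) * (n : ℂ) ^ (-s) + ((n + 1 : ℕ) : ℂ) ^ (1 - s) - (n : ℂ) ^ (1 - s)

lemma hasDerivAt_ofReal_cpow_of_pos {u : ℝ} (hu : 0 < u) (r : ℂ) :
    HasDerivAt (fun y : ℝ => (y : ℂ) ^ r) (r * (u : ℂ) ^ (r - 1)) u := by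
  have h := (hasDerivAt_id (u : ℂ)).cpow_const (c := r) (Or.inl (by simpa using hu))
  simpa using h.comp_ofReal

lemma norm_ofReal_cpow_sub_le {s : ℂ} (hs : 0 < s.re) {a u : ℝ} (ha : 0 < a)
    (hu : u ∈ Set.Icc a (a + 1)) :
    ‖(u : ℂ) ^ (-s) - (a : ℂ) ^ (-s)‖ ≤ ‖s‖ * a ^ (-s.re - 1) := by
  have key := (convex_Icc a (a + 1)).norm_image_sub_le_of_norm_hasDerivWithin_le
    (f := fun y : ℝ => (y : ℂ) ^ (-s)) (f' := fun y : ℝ => -s * (y : ℂ) ^ (-s - 1))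
    (C := ‖s‖ * a ^ (-s.re - 1)) (x := a) (y := u)
    (fun y hy => (hasDerivAt_ofReal_cpow_of_pos (lt_of_lt_of_le ha hy.1) _).hasDerivWithinAt)
    (fun y hy => by
      have hy0 : 0 < y := lt_of_lt_of_le ha hy.1
      rw [norm_mul, norm_neg, Complex.norm_cpow_eq_rpow_re_of_pos hy0]
      simp only [Complex.sub_re, Complex.neg_re, Complex.one_re]
      gcongr ‖s‖ * ?_
      exact rpow_le_rpow_of_nonpos ha hy.1 (by linarith))
    (by simp) hu
  refine key.trans ?_
  have : ‖u - a‖ ≤ 1 := by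
    rw [Real.norm_eq_abs, abs_le]; constructor <;> linarith [hu.1, hu.2]
  exact mul_le_of_le_one_right (by positivity) this

lemma norm_rectangleError_le {s : ℂ} (hs : 0 < s.re) {n : ℕ} (hn : 0 < n) :
    ‖rectangleError s n‖ ≤ ‖s - 1‖ * ‖s‖ * (n : ℝ) ^ (-s.re - 1) := by
  have hn0 : (0 : ℝ) < n := by exact_mod_cast hn
  have key := (convex_Icc (n : ℝ) (n + 1)).norm_image_sub_le_of_norm_hasDerivWithin_le
    (f := fun y : ℝ => (y : ℂ) ^ (1 - s) - (1 - s) * (n : ℂ) ^ (-s) * (y : ℂ))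
    (f' := fun y : ℝ => (1 - s) * (y : ℂ) ^ (1 - s - 1) - (1 - s) * (n : ℂ) ^ (-s) * 1)
    (C := ‖s - 1‖ * ‖s‖ * (n : ℝ) ^ (-s.re - 1)) (x := n) (y := n + 1)
    (fun y hy => by
      refine HasDerivAt.hasDerivWithinAt (HasDerivAt.sub ?_ (HasDerivAt.const_mul _ ?_))
      · exact hasDerivAt_ofReal_cpow_of_pos (lt_of_lt_of_le hn0 hy.1) _
      · exact Complex.ofRealCLM.hasDerivAt)
    (fun y hy => by
      have h := norm_ofReal_cpow_sub_le hs hn0 hy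
      rw [Complex.ofReal_natCast] at h
      have e : (1 - s) * (y : ℂ) ^ (1 - s - 1) - (1 - s) * (n : ℂ) ^ (-s) * 1
          = (1 - s) * ((y : ℂ) ^ (-s) - (n : ℂ) ^ (-s)) := by
        rw [show 1 - s - 1 = -s by ring]; ring
      rw [e, norm_mul, norm_sub_rev, mul_assoc]
      gcongr)
    (by simp) (by simp)
  have e : rectangleError s n = ((((n : ℝ) + 1 : ℝ) : ℂ) ^ (1 - s) -
      (1 - s) * (n : ℂ) ^ (-s) * ((n : ℝ) + 1 : ℝ))
      - (((n : ℝ) : ℂ) ^ (1 - s) - (1 - s) * (n : ℂ) ^ (-s) * ((n : ℝ) : ℂ)) := by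
    rw [rectangleError]; push_cast; ring
  rw [e]
  simpa using key

lemma sum_rectangleError (s : ℂ) (N : ℕ) :
    ∑ n ∈ Finset.range N, rectangleError s (n + 1) =
      (s - 1) * ∑ n ∈ Finset.range N, ((n + 1 : ℕ) : ℂ) ^ (-s) +
        ((N + 1 : ℕ) : ℂ) ^ (1 - s) - 1 := by
  induction N with
  | zero => simp
  | succ N ih => rw [Finset.sum_range_succ, ih, Finset.sum_range_succ, rectangleError]; ring

lemma summable_rectangleError {s : ℂ} (hs : 0 < s.re) :
    Summable fun n : ℕ => rectangleError s (n + 1) := by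
  refine Summable.of_norm_bounded
    (g := fun n : ℕ => ‖s - 1‖ * ‖s‖ * ((n + 1 : ℕ) : ℝ) ^ (-s.re - 1)) ?_
    (fun n => norm_rectangleError_le hs n.succ_pos)
  refine Summable.mul_left _ ((summable_nat_add_iff 1).2 (Real.summable_nat_rpow.2 (by linarith)))

lemma zetaPole_eq_of_one_lt_re {s : ℂ} (hs : 1 < s.re) :
    zetaPole s = 1 + ∑' n : ℕ, rectangleError s (n + 1) := by
  have hs1 : s ≠ 1 := by rintro rfl; simp at hs
  have h1 := (summable_rectangleError (s := s) (by linarith)).hasSum.tendsto_sum_nat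
  simp_rw [sum_rectangleError] at h1
  have hz : Filter.Tendsto (fun N : ℕ => ∑ n ∈ Finset.range N, ((n + 1 : ℕ) : ℂ) ^ (-s))
      Filter.atTop (nhds (riemannZeta s)) := by
    have := (summable_nat_add_iff 1).2 (Complex.summable_one_div_nat_cpow.2 hs)
    have h2 := this.hasSum.tendsto_sum_nat
    rw [zeta_eq_tsum_one_div_nat_add_one_cpow hs]
    simpa [Complex.cpow_neg] using h2
  have h0 : Filter.Tendsto (fun N : ℕ => ((N + 1 : ℕ) : ℂ) ^ (1 - s)) Filter.atTop (nhds 0) := by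
    rw [tendsto_zero_iff_norm_tendsto_zero]
    have h3 : Filter.Tendsto (fun N : ℕ => ((N : ℕ) : ℝ) ^ (-(s.re - 1))) Filter.atTop (nhds 0) :=
      (tendsto_rpow_neg_atTop (by linarith)).comp tendsto_natCast_atTop_atTop
    have h4 := (Filter.tendsto_add_atTop_iff_nat 1).2 h3
    refine h4.congr fun N => ?_
    rw [Complex.norm_natCast_cpow_of_pos N.succ_pos]
    simp
  have := tendsto_nhds_unique h1 (((hz.const_mul (s - 1)).add h0).sub_const 1)
  rw [this, zetaPole_of_ne hs1]; ring

lemma zetaPole_eq {s : ℂ} (hs : 0 < s.re) :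
    zetaPole s = 1 + ∑' n : ℕ, rectangleError s (n + 1) := by
  have hopen : IsOpen {z : ℂ | 0 < z.re} := isOpen_lt continuous_const Complex.continuous_re
  have hdiff : DifferentiableOn ℂ (fun s => 1 + ∑' n : ℕ, rectangleError s (n + 1))
      {z : ℂ | 0 < z.re} := by
    intro z hz
    obtain ⟨δ, hδ0, hδ⟩ : ∃ δ, 0 < δ ∧ δ < z.re := ⟨z.re / 2, half_pos hz, half_lt_self hz⟩
    set V : Set ℂ := {w : ℂ | δ < w.re} ∩ Metric.ball 0 (‖z‖ + 1) with hV
    have hVo : IsOpen V :=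
      (isOpen_lt continuous_const Complex.continuous_re).inter Metric.isOpen_ball
    have hzV : z ∈ V := ⟨hδ, by simp⟩
    have := Complex.differentiableOn_tsum_of_summable_norm
      (F := fun (n : ℕ) (w : ℂ) => rectangleError w (n + 1))
      (u := fun n : ℕ => (‖z‖ + 2) * (‖z‖ + 1) * ((n + 1 : ℕ) : ℝ) ^ (-δ - 1)) (U := V)
      (Summable.mul_left _ ((summable_nat_add_iff 1).2 (Real.summable_nat_rpow.2 (by linarith))))
      (fun n w _ => by
        have h1 : ((n + 1 : ℕ) : ℂ) ≠ 0 := by exact_mod_cast n.succ_ne_zero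
        have h2 : ((n + 1 + 1 : ℕ) : ℂ) ≠ 0 := by exact_mod_cast (n + 1).succ_ne_zero
        unfold rectangleError
        refine DifferentiableAt.differentiableWithinAt ?_
        refine ((DifferentiableAt.mul (by fun_prop) ?_).add ?_).sub ?_
        · exact DifferentiableAt.const_cpow (by fun_prop) (Or.inl h1)
        · exact DifferentiableAt.const_cpow (by fun_prop) (Or.inl h2)
        · exact DifferentiableAt.const_cpow (by fun_prop) (Or.inl h1)) hVo
      (fun n w hw => by
        have hw1 : δ < w.re := hw.1
        have hw2 : ‖w‖ < ‖z‖ + 1 := by simpa using hw.2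
        refine (norm_rectangleError_le (hδ0.trans hw1) n.succ_pos).trans ?_
        have : ‖w - 1‖ ≤ ‖z‖ + 2 := (norm_sub_le _ _).trans (by simp; linarith)
        gcongr
        simp)
    exact ((this.differentiableAt (hVo.mem_nhds hzV)).const_add 1).differentiableWithinAt
  have := AnalyticOnNhd.eqOn_of_preconnected_of_eventuallyEq
    (differentiable_zetaPole.differentiableOn.analyticOnNhd hopen) (hdiff.analyticOnNhd hopen)
    (convex_halfSpace_re_gt 0).isPreconnected (z₀ := 2) (by simp)
    (by
      have : {z : ℂ | 1 < z.re} ∈ nhds (2 : ℂ) :=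
        (isOpen_lt continuous_const Complex.continuous_re).mem_nhds (by simp)
      filter_upwards [this] with w hw using zetaPole_eq_of_one_lt_re hw)
  exact this hs

lemma zetaPole_eq_sum_add {s : ℂ} (hs : 0 < s.re) (N : ℕ) :
    zetaPole s = (s - 1) * ∑ n ∈ Finset.range N, ((n + 1 : ℕ) : ℂ) ^ (-s) +
      ((N + 1 : ℕ) : ℂ) ^ (1 - s) + ∑' n : ℕ, rectangleError s (n + N + 1) := by
  rw [zetaPole_eq hs, ← (summable_rectangleError hs).sum_add_tsum_nat_add N,
    sum_rectangleError]
  ring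

lemma norm_riemannZeta_le_sum {s : ℂ} {N : ℕ} (h1 : 119 / 120 ≤ s.re) (h3 : s.re ≤ 3)
    (ht : 1 ≤ |s.im|) (hN : s.im ^ 2 ≤ N + 1) :
    ‖riemannZeta s‖ ≤ ((∑' n : ℕ, ((n + 1 : ℕ) : ℝ) ^ (-(121 / 120) : ℝ)) + 1 +
      4 * ∑' n : ℕ, ((n + 1 : ℕ) : ℝ) ^ (-(3 / 2) : ℝ)) * ((N + 1 : ℕ) : ℝ) ^ (1 / 60 : ℝ) := by
  have hs : 0 < s.re := by linarith
  have hs1 : s ≠ 1 := by rintro rfl; simp at ht; linarith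
  have hM : (1 : ℝ) ≤ ((N + 1 : ℕ) : ℝ) := by simp
  have hsub : |s.im| ≤ ‖s - 1‖ := by simpa using Complex.abs_im_le_norm (s - 1)
  have hsub0 : 0 < ‖s - 1‖ := by linarith
  have sum1 : Summable fun n : ℕ => ((n + 1 : ℕ) : ℝ) ^ (-(121 / 120) : ℝ) :=
    (summable_nat_add_iff 1).2 (Real.summable_nat_rpow.2 (by norm_num))
  have sum2 : Summable fun n : ℕ => ((n + 1 : ℕ) : ℝ) ^ (-(3 / 2) : ℝ) :=
    (summable_nat_add_iff 1).2 (Real.summable_nat_rpow.2 (by norm_num))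
  set M : ℝ := ((N + 1 : ℕ) : ℝ) with hMdef
  set Z1 := ∑' n : ℕ, ((n + 1 : ℕ) : ℝ) ^ (-(121 / 120) : ℝ)
  set Z2 := ∑' n : ℕ, ((n + 1 : ℕ) : ℝ) ^ (-(3 / 2) : ℝ)
  have hM0 : 0 < M := by linarith
  have b1 : ‖∑ n ∈ Finset.range N, ((n + 1 : ℕ) : ℂ) ^ (-s)‖ ≤ Z1 * M ^ (1 / 60 : ℝ) := by
    calc _ ≤ ∑ n ∈ Finset.range N, ((n + 1 : ℕ) : ℝ) ^ (-(121 / 120) : ℝ) * M ^ (1 / 60 : ℝ) := by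
          refine norm_sum_le_of_le _ fun n hn => ?_
          rw [Complex.norm_natCast_cpow_of_pos n.succ_pos, Complex.neg_re]
          have hn1 : (1 : ℝ) ≤ ((n + 1 : ℕ) : ℝ) := by simp
          calc ((n + 1 : ℕ) : ℝ) ^ (-s.re)
              ≤ ((n + 1 : ℕ) : ℝ) ^ (-(121 / 120) + 1 / 60 : ℝ) :=
                rpow_le_rpow_of_exponent_le hn1 (by linarith)
            _ = ((n + 1 : ℕ) : ℝ) ^ (-(121 / 120) : ℝ) * ((n + 1 : ℕ) : ℝ) ^ (1 / 60 : ℝ) :=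
                rpow_add (by linarith) _ _
            _ ≤ _ := by
                gcongr
                rw [hMdef]
                have := Finset.mem_range.1 hn
                exact_mod_cast (by omega : n + 1 ≤ N + 1)
      _ = (∑ n ∈ Finset.range N, ((n + 1 : ℕ) : ℝ) ^ (-(121 / 120) : ℝ)) * M ^ (1 / 60 : ℝ) := by
          rw [Finset.sum_mul]
      _ ≤ _ := by
          gcongr
          exact sum1.sum_le_tsum _ (fun n _ => by positivity)
  have b2 : ‖((N + 1 : ℕ) : ℂ) ^ (1 - s)‖ ≤ M ^ (1 / 60 : ℝ) := by
    rw [Complex.norm_natCast_cpow_of_pos N.succ_pos]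
    refine rpow_le_rpow_of_exponent_le hM ?_
    simp; linarith
  have b3 : ‖∑' n : ℕ, rectangleError s (n + N + 1)‖ ≤
      ‖s - 1‖ * (4 * Z2 * M ^ (1 / 60 : ℝ)) := by
    have hb : ∀ n : ℕ, ‖rectangleError s (n + N + 1)‖ ≤
        ‖s - 1‖ * (‖s‖ * M ^ (-(1 / 2) + 1 / 60 : ℝ)) * ((n + 1 : ℕ) : ℝ) ^ (-(3 / 2) : ℝ) := by
      intro n
      refine (norm_rectangleError_le hs (Nat.succ_pos _)).trans ?_
      have hn1 : (1 : ℝ) ≤ ((n + N + 1 : ℕ) : ℝ) := by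
        push_cast
        linarith [n.cast_nonneg (α := ℝ), N.cast_nonneg (α := ℝ)]
      have : ((n + N + 1 : ℕ) : ℝ) ^ (-s.re - 1) ≤
          M ^ (-(1 / 2) + 1 / 60 : ℝ) * ((n + 1 : ℕ) : ℝ) ^ (-(3 / 2) : ℝ) := by
        calc ((n + N + 1 : ℕ) : ℝ) ^ (-s.re - 1)
            ≤ ((n + N + 1 : ℕ) : ℝ) ^ ((-(1 / 2) + 1 / 60) + -(3 / 2) : ℝ) :=
              rpow_le_rpow_of_exponent_le hn1 (by linarith)
          _ = ((n + N + 1 : ℕ) : ℝ) ^ (-(1 / 2) + 1 / 60 : ℝ) *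
              ((n + N + 1 : ℕ) : ℝ) ^ (-(3 / 2) : ℝ) := rpow_add (by linarith) _ _
          _ ≤ _ := by
              refine mul_le_mul ?_ ?_ (by positivity) (by positivity)
              · refine rpow_le_rpow_of_nonpos hM0 ?_ (by norm_num)
                rw [hMdef]; exact_mod_cast (by omega : N + 1 ≤ n + N + 1)
              · refine rpow_le_rpow_of_nonpos (by positivity) ?_ (by norm_num)
                exact_mod_cast (by omega : n + 1 ≤ n + N + 1)
      calc _ ≤ ‖s - 1‖ * ‖s‖ * (M ^ (-(1 / 2) + 1 / 60 : ℝ) *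
            ((n + 1 : ℕ) : ℝ) ^ (-(3 / 2) : ℝ)) := by
            gcongr
        _ = _ := by ring
    have h := tsum_of_norm_bounded (sum2.hasSum.mul_left _) hb
    refine h.trans ?_
    rw [mul_assoc]
    refine mul_le_mul_of_nonneg_left ?_ hsub0.le
    have hsn : ‖s‖ ≤ 4 * |s.im| := by
      refine (Complex.norm_le_abs_re_add_abs_im s).trans ?_
      rw [abs_of_pos hs]; linarith
    have hMi : |s.im| * M ^ (-(1 / 2) : ℝ) ≤ 1 := by
      rw [rpow_neg hM0.le, ← Real.sqrt_eq_rpow, ← div_eq_mul_inv]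
      refine div_le_one_of_le₀ (Real.abs_le_sqrt ?_) (Real.sqrt_nonneg _)
      rw [hMdef]; push_cast; exact hN
    have hZ2 : 0 ≤ Z2 := tsum_nonneg fun n => by positivity
    rw [rpow_add hM0]
    calc ‖s‖ * (M ^ (-(1 / 2) : ℝ) * M ^ (1 / 60 : ℝ)) * Z2
        ≤ (4 * |s.im|) * (M ^ (-(1 / 2) : ℝ) * M ^ (1 / 60 : ℝ)) * Z2 := by gcongr
      _ = 4 * (|s.im| * M ^ (-(1 / 2) : ℝ)) * M ^ (1 / 60 : ℝ) * Z2 := by ring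
      _ ≤ 4 * 1 * M ^ (1 / 60 : ℝ) * Z2 := by gcongr
      _ = _ := by ring
  have key : ‖s - 1‖ * ‖riemannZeta s‖ ≤ ‖s - 1‖ * ((Z1 + 1 + 4 * Z2) * M ^ (1 / 60 : ℝ)) := by
    rw [← norm_mul, ← zetaPole_of_ne hs1, zetaPole_eq_sum_add hs N]
    refine (norm_add₃_le).trans ?_
    rw [norm_mul]
    have : M ^ (1 / 60 : ℝ) ≤ ‖s - 1‖ * M ^ (1 / 60 : ℝ) :=
      le_mul_of_one_le_left (by positivity) (ht.trans hsub)
    have := mul_le_mul_of_nonneg_left b1 hsub0.le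
    nlinarith
  exact le_of_mul_le_mul_left key hsub0

lemma exists_norm_riemannZeta_le : ∃ C : ℝ, 0 < C ∧ ∀ s : ℂ, 119 / 120 ≤ s.re → s.re ≤ 3 →
    1 ≤ |s.im| → ‖riemannZeta s‖ ≤ C * |s.im| ^ (1 / 30 : ℝ) := by
  refine ⟨((∑' n : ℕ, ((n + 1 : ℕ) : ℝ) ^ (-(121 / 120) : ℝ)) + 1 +
      4 * ∑' n : ℕ, ((n + 1 : ℕ) : ℝ) ^ (-(3 / 2) : ℝ)) * 3, ?_, fun s h1 h3 ht => ?_⟩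
  · have h1 : 0 ≤ ∑' n : ℕ, ((n + 1 : ℕ) : ℝ) ^ (-(121 / 120) : ℝ) :=
      tsum_nonneg fun n => by positivity
    have h2 : 0 ≤ ∑' n : ℕ, ((n + 1 : ℕ) : ℝ) ^ (-(3 / 2) : ℝ) :=
      tsum_nonneg fun n => by positivity
    positivity
  · have hN : s.im ^ 2 ≤ (⌈s.im ^ 2⌉₊ : ℝ) := Nat.le_ceil _
    have hN2 : (⌈s.im ^ 2⌉₊ : ℝ) < s.im ^ 2 + 1 := Nat.ceil_lt_add_one (sq_nonneg _)
    refine (norm_riemannZeta_le_sum h1 h3 ht (N := ⌈s.im ^ 2⌉₊) (by linarith)).trans ?_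
    have h1 : 0 ≤ ∑' n : ℕ, ((n + 1 : ℕ) : ℝ) ^ (-(121 / 120) : ℝ) :=
      tsum_nonneg fun n => by positivity
    have h2 : 0 ≤ ∑' n : ℕ, ((n + 1 : ℕ) : ℝ) ^ (-(3 / 2) : ℝ) :=
      tsum_nonneg fun n => by positivity
    rw [mul_assoc]
    refine mul_le_mul_of_nonneg_left ?_ (by positivity)
    have hsq : 1 ≤ s.im ^ 2 := by rw [← sq_abs]; nlinarith
    calc ((⌈s.im ^ 2⌉₊ + 1 : ℕ) : ℝ) ^ (1 / 60 : ℝ) ≤ (3 * |s.im| ^ (2 : ℝ)) ^ (1 / 60 : ℝ) := by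
          refine rpow_le_rpow (by positivity) ?_ (by norm_num)
          rw [rpow_two, sq_abs]; push_cast; linarith
      _ = 3 ^ (1 / 60 : ℝ) * |s.im| ^ (1 / 30 : ℝ) := by
          rw [mul_rpow (by norm_num) (by positivity), ← rpow_mul (abs_nonneg _)]; norm_num
      _ ≤ 3 * |s.im| ^ (1 / 30 : ℝ) := by
          gcongr
          calc (3 : ℝ) ^ (1 / 60 : ℝ) ≤ 3 ^ (1 : ℝ) :=
                rpow_le_rpow_of_exponent_le (by norm_num) (by norm_num)
            _ = 3 := rpow_one 3

lemma exists_norm_iteratedDeriv_riemannZeta_le : ∃ C : ℝ, 1 ≤ C ∧ ∀ s : ℂ, 1 ≤ s.re →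
    s.re ≤ 2 → 2 ≤ |s.im| → ‖riemannZeta (s + s.im * Complex.I)‖ ≤ C * |s.im| ^ (1 / 30 : ℝ) ∧
      ∀ k ≤ 3, ‖iteratedDeriv k riemannZeta s‖ ≤ C * |s.im| ^ (1 / 30 : ℝ) := by
  obtain ⟨C, hC, hb⟩ := exists_norm_riemannZeta_le
  refine ⟨max 1 (6 * 120 ^ 3 * (C * 2)), le_max_left _ _, fun s h1 h2 ht => ?_⟩
  have hpow : ∀ u : ℝ, 0 ≤ u → u ≤ 2 * |s.im| → u ^ (1 / 30 : ℝ) ≤ 2 * |s.im| ^ (1 / 30 : ℝ) := by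
    intro u hu0 hu
    calc u ^ (1 / 30 : ℝ) ≤ (2 * |s.im|) ^ (1 / 30 : ℝ) := rpow_le_rpow hu0 hu (by norm_num)
      _ = 2 ^ (1 / 30 : ℝ) * |s.im| ^ (1 / 30 : ℝ) := mul_rpow (by norm_num) (abs_nonneg _)
      _ ≤ 2 * |s.im| ^ (1 / 30 : ℝ) := by
          gcongr
          calc (2 : ℝ) ^ (1 / 30 : ℝ) ≤ 2 ^ (1 : ℝ) :=
                rpow_le_rpow_of_exponent_le (by norm_num) (by norm_num)
            _ = 2 := rpow_one 2
  have hp : 0 ≤ |s.im| ^ (1 / 30 : ℝ) := by positivity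
  have hmax : ∀ a : ℝ, a ≤ 6 * 120 ^ 3 → a * (C * (2 * |s.im| ^ (1 / 30 : ℝ))) ≤
      max 1 (6 * 120 ^ 3 * (C * 2)) * |s.im| ^ (1 / 30 : ℝ) := by
    intro a ha
    calc a * (C * (2 * |s.im| ^ (1 / 30 : ℝ)))
        ≤ (6 * 120 ^ 3) * (C * (2 * |s.im| ^ (1 / 30 : ℝ))) := by gcongr
      _ = (6 * 120 ^ 3 * (C * 2)) * |s.im| ^ (1 / 30 : ℝ) := by ring
      _ ≤ _ := by gcongr; exact le_max_right _ _
  constructor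
  · have e : |(s + s.im * Complex.I).im| = 2 * |s.im| := by
      simp only [Complex.add_im, Complex.mul_im, Complex.ofReal_re, Complex.I_im, mul_one,
        Complex.ofReal_im, Complex.I_re, mul_zero, add_zero]
      rw [← two_mul, abs_mul, abs_two]
    refine (hb _ (by simp; linarith) (by simp; linarith) (by rw [e]; linarith)).trans ?_
    rw [e]
    refine le_trans ?_ (hmax 1 (by norm_num))
    rw [one_mul]
    gcongr
    exact hpow _ (by positivity) le_rfl
  · intro k hk
    have hball : ∀ z ∈ Metric.closedBall s (1 / 120), 119 / 120 ≤ z.re ∧ z.re ≤ 3 ∧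
        1 ≤ |z.im| ∧ |z.im| ≤ 2 * |s.im| := by
      intro z hz
      rw [Metric.mem_closedBall, Complex.dist_eq] at hz
      have hre := abs_le.1 ((Complex.abs_re_le_norm (z - s)).trans hz)
      have him := (Complex.abs_im_le_norm (z - s)).trans hz
      rw [Complex.sub_re] at hre
      rw [Complex.sub_im] at him
      have i1 := abs_sub_abs_le_abs_sub s.im z.im
      rw [abs_sub_comm] at i1
      have i2 := abs_sub_abs_le_abs_sub z.im s.im
      refine ⟨by linarith, by linarith, by linarith, by linarith⟩
    have hd : DiffContOnCl ℂ riemannZeta (Metric.ball s (1 / 120)) := by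
      refine DifferentiableOn.diffContOnCl fun z hz => ?_
      rw [closure_ball _ (by norm_num)] at hz
      have := (hball z hz).2.2.1
      refine (differentiableAt_riemannZeta ?_).differentiableWithinAt
      rintro rfl
      simp at this
      linarith
    refine (Complex.norm_iteratedDeriv_le_of_forall_mem_sphere_norm_le k (by norm_num) hd
      (C := C * (2 * |s.im| ^ (1 / 30 : ℝ))) fun z hz => ?_).trans ?_
    · obtain ⟨z1, z2, z3, z4⟩ := hball z (Metric.sphere_subset_closedBall hz)
      refine (hb z z1 z2 z3).trans ?_
      gcongr
      exact hpow _ (abs_nonneg _) z4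
    · rw [mul_div_right_comm]
      refine hmax _ ?_
      interval_cases k <;> norm_num [Nat.factorial]

lemma one_le_norm_riemannZeta_product {x : ℝ} (hx : 0 < x) (t : ℝ) :
    1 ≤ ‖riemannZeta (1 + x)‖ ^ 3 * ‖riemannZeta (1 + x + Complex.I * t)‖ ^ 4 *
      ‖riemannZeta (1 + x + 2 * Complex.I * t)‖ := by
  have := DirichletCharacter.norm_LFunction_product_ge_one (N := 1)
    (1 : DirichletCharacter ℂ 1) hx t
  simpa [DirichletCharacter.LFunctionTrivChar] using this

lemma exists_norm_riemannZeta_one_add_le : ∃ B : ℝ, 1 ≤ B ∧ ∀ x : ℝ, 0 < x → x ≤ 1 →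
    ‖riemannZeta (1 + x)‖ ≤ B / x := by
  have hc : ContinuousOn (fun x : ℝ => zetaPole (1 + x)) (Set.Icc 0 1) :=
    (differentiable_zetaPole.continuous.comp (by fun_prop)).continuousOn
  obtain ⟨B, hB⟩ := isCompact_Icc.exists_bound_of_continuousOn hc
  refine ⟨max 1 B, le_max_left _ _, fun x hx hx1 => ?_⟩
  rw [le_div_iff₀ hx, mul_comm]
  refine le_trans ?_ ((hB x ⟨hx.le, hx1⟩).trans (le_max_right _ _))
  have : (1 + x : ℂ) ≠ 1 := by simpa using hx.ne'
  rw [zetaPole_of_ne this, norm_mul]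
  simp [abs_of_pos hx]

lemma exists_le_norm_riemannZeta : ∃ C : ℝ, 1 ≤ C ∧ ∃ c : ℝ, 0 < c ∧ ∀ s : ℂ, 1 < s.re →
    s.re ≤ 2 → 2 ≤ |s.im| →
      (∀ k ≤ 3, ‖iteratedDeriv k riemannZeta s‖ ≤ C * |s.im| ^ (1 / 30 : ℝ)) ∧
      c / (C * |s.im| ^ (1 / 30 : ℝ)) ^ 4 ≤ ‖riemannZeta s‖ := by
  obtain ⟨C, hC, hder⟩ := exists_norm_iteratedDeriv_riemannZeta_le
  obtain ⟨B, hB, hpole⟩ := exists_norm_riemannZeta_one_add_le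
  set c : ℝ := 1 / (16 * B ^ 3) with hc
  have hc0 : 0 < c := by positivity
  have hc1 : c ≤ 1 := by
    rw [hc, div_le_one (by positivity)]
    linarith [one_le_pow₀ hB (n := 3)]
  refine ⟨C, hC, c, hc0, fun s h1 h2 ht => ⟨(hder s h1.le h2 ht).2, ?_⟩⟩
  set t := s.im
  set M : ℝ := C * |t| ^ (1 / 30 : ℝ) with hM
  have hM1 : 1 ≤ M := one_le_mul_of_one_le_of_one_le hC
    (one_le_rpow (by linarith) (by norm_num))
  have hM0 : 0 < M := by linarith
  have lower : ∀ x : ℝ, 0 < x → x ≤ 1 →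
      16 * c * x ^ 3 / M ≤ ‖riemannZeta (1 + x + Complex.I * t)‖ ^ 4 := by
    intro x hx hx1
    have h := one_le_norm_riemannZeta_product hx t
    have h3 := hpole x hx hx1
    have him : (1 + x + Complex.I * t : ℂ).im = t := by simp
    have hre : (1 + x + Complex.I * t : ℂ).re = 1 + x := by simp
    have h4 := (hder (1 + x + Complex.I * t) (by rw [hre]; linarith) (by rw [hre]; linarith)
      (by rwa [him])).1
    rw [him, ← hM, show (1 + x + Complex.I * t + t * Complex.I : ℂ)
      = 1 + x + 2 * Complex.I * t by ring] at h4
    set z := ‖riemannZeta (1 + x + Complex.I * t)‖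
    have h5 : 1 ≤ (B / x) ^ 3 * z ^ 4 * M := by
      refine h.trans ?_
      gcongr
    have e : 16 * c * x ^ 3 / M * ((B / x) ^ 3 * M) = 1 := by
      rw [hc]; field_simp
    have h6 : 16 * c * x ^ 3 / M * ((B / x) ^ 3 * M) ≤ z ^ 4 * ((B / x) ^ 3 * M) := by
      rw [e]; linarith
    exact le_of_mul_le_mul_right h6 (by positivity)
  set x₀ : ℝ := c / M ^ 5 with hx₀
  have hx₀0 : 0 < x₀ := by positivity
  have hx₀1 : x₀ ≤ 1 := div_le_one_of_le₀ (hc1.trans (one_le_pow₀ hM1)) (by positivity)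
  have far : ∀ x : ℝ, x₀ ≤ x → x ≤ 1 → 2 * c / M ^ 4 ≤ ‖riemannZeta (1 + x + Complex.I * t)‖ := by
    intro x hx hx1
    refine le_of_pow_le_pow_left₀ four_ne_zero (norm_nonneg _) ?_
    refine le_trans ?_ (lower x (hx₀0.trans_le hx) hx1)
    calc (2 * c / M ^ 4) ^ 4 = 16 * c * x₀ ^ 3 / M := by
          rw [hx₀]; field_simp; ring
      _ ≤ 16 * c * x ^ 3 / M := by gcongr
  have hs : s = 1 + ((s.re - 1 : ℝ) : ℂ) + Complex.I * t := by
    apply Complex.ext <;> simp [t]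
  rcases le_total x₀ (s.re - 1) with h | h
  · have := far _ h (by linarith)
    rw [← hs] at this
    refine le_trans ?_ this
    gcongr; linarith
  · have hf := far x₀ le_rfl hx₀1
    set w : ℂ := 1 + x₀ + Complex.I * t with hw
    have hwre : w.re = 1 + x₀ := by simp [hw]
    have hwim : w.im = t := by simp [hw]
    have hmv := (convex_segment s w).norm_image_sub_le_of_norm_deriv_le
      (𝕜 := ℂ) (f := riemannZeta) (C := M) (x := s) (y := w)
    have hseg : ∀ z ∈ segment ℝ s w, 1 ≤ z.re ∧ z.re ≤ 2 ∧ z.im = t := by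
      rintro z ⟨a, b, ha, hb, hab, rfl⟩
      simp only [Complex.add_re, Complex.real_smul, Complex.mul_re, Complex.ofReal_re,
        Complex.ofReal_im, zero_mul, sub_zero, Complex.add_im, Complex.mul_im, add_zero,
        hwre, hwim]
      refine ⟨by nlinarith, by nlinarith, ?_⟩
      rw [← add_mul, hab, one_mul]
    have h7 := hmv (fun z hz => by
        obtain ⟨_, _, h⟩ := hseg z hz
        refine differentiableAt_riemannZeta ?_
        rintro rfl
        rw [← h] at ht
        simp at ht
        linarith)
      (fun z hz => by
        obtain ⟨z1, z2, z3⟩ := hseg z hz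
        have := (hder z z1 z2 (by rwa [z3])).2 1 (by norm_num)
        rwa [iteratedDeriv_one, z3] at this)
      (left_mem_segment _ _ _) (right_mem_segment _ _ _)
    have h8 : ‖w - s‖ ≤ x₀ := by
      have : w - s = ((x₀ - (s.re - 1) : ℝ) : ℂ) := by
        apply Complex.ext <;> simp [hwre, hwim, t]; ring
      rw [this, Complex.norm_real, Real.norm_eq_abs, abs_le]
      constructor <;> linarith
    have h9 : M * ‖w - s‖ ≤ c / M ^ 4 := by
      calc M * ‖w - s‖ ≤ M * x₀ := by gcongr
        _ = c / M ^ 4 := by rw [hx₀]; field_simp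
    have h10 := norm_sub_norm_le (riemannZeta w) (riemannZeta s)
    have h11 : 2 * c / M ^ 4 = c / M ^ 4 + c / M ^ 4 := by ring
    linarith

/-- The deviation `(Λ(n) - 1) log² n` of the von Mangoldt function from its mean value,
weighted by `log² n`. -/
noncomputable def logSqDeviation (n : ℕ) : ℝ :=
  (ArithmeticFunction.vonMangoldt n - 1) * log n ^ 2

/-- The sequence `Λ(n) - 1`. -/
noncomputable def vonMangoldtSubOne (n : ℕ) : ℂ :=
  (ArithmeticFunction.vonMangoldt n : ℂ) - 1

lemma LSeriesSummable_vonMangoldtSubOne {s : ℂ} (hs : 1 < s.re) :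
    LSeriesSummable vonMangoldtSubOne s :=
  (ArithmeticFunction.LSeriesSummable_vonMangoldt hs).sub (LSeriesSummable_one_iff.2 hs)

lemma abscissaOfAbsConv_vonMangoldtSubOne_lt {s : ℂ} (hs : 1 < s.re) :
    LSeries.abscissaOfAbsConv vonMangoldtSubOne < s.re := by
  refine lt_of_le_of_lt (LSeries.abscissaOfAbsConv_le_of_forall_lt_LSeriesSummable (x := 1)
    fun y hy => LSeriesSummable_vonMangoldtSubOne (by simpa using hy)) ?_
  exact_mod_cast hs

lemma LSeries_vonMangoldtSubOne {s : ℂ} (hs : 1 < s.re) :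
    LSeries vonMangoldtSubOne s = -(deriv riemannZeta s / riemannZeta s) - riemannZeta s := by
  rw [← LSeries_one_eq_riemannZeta hs, ← neg_div, LSeries_one_eq_riemannZeta hs,
    ← ArithmeticFunction.LSeries_vonMangoldt_eq_deriv_riemannZeta_div hs,
    ← LSeries_one_eq_riemannZeta hs]
  exact LSeries_sub (ArithmeticFunction.LSeriesSummable_vonMangoldt hs)
    (LSeriesSummable_one_iff.2 hs)

lemma logMul_logMul_vonMangoldtSubOne :
    LSeries.logMul^[2] vonMangoldtSubOne = fun n => (logSqDeviation n : ℂ) := by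
  ext n
  simp only [Function.iterate_succ, Function.iterate_zero, Function.comp_apply, id,
    LSeries.logMul, vonMangoldtSubOne, logSqDeviation]
  rw [← Complex.natCast_log]
  push_cast
  ring

lemma LSeriesSummable_logSqDeviation {s : ℂ} (hs : 1 < s.re) :
    LSeriesSummable (fun n => (logSqDeviation n : ℂ)) s := by
  rw [← logMul_logMul_vonMangoldtSubOne]
  refine LSeriesSummable_of_abscissaOfAbsConv_lt_re ?_
  rw [LSeries.absicssaOfAbsConv_logPowMul]
  exact abscissaOfAbsConv_vonMangoldtSubOne_lt hs

lemma LSeries_logSqDeviation {s : ℂ} (hs : 1 < s.re) :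
    LSeries (fun n => (logSqDeviation n : ℂ)) s =
      iteratedDeriv 2 (LSeries vonMangoldtSubOne) s := by
  rw [LSeries_iteratedDeriv 2 (abscissaOfAbsConv_vonMangoldtSubOne_lt hs),
    logMul_logMul_vonMangoldtSubOne]
  simp

lemma isOpen_one_lt_re : IsOpen {z : ℂ | 1 < z.re} :=
  isOpen_lt continuous_const Complex.continuous_re

lemma LSeries_vonMangoldtSubOne_eq_zetaPole {s : ℂ} (hs : 1 < s.re) :
    LSeries vonMangoldtSubOne s =
      -(deriv zetaPole s / zetaPole s) - dslope zetaPole 1 s := by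
  have hs1 : s ≠ 1 := by rintro rfl; simp at hs
  have hsub : s - 1 ≠ 0 := sub_ne_zero.2 hs1
  have hz : riemannZeta s ≠ 0 := riemannZeta_ne_zero_of_one_lt_re hs
  have hd : deriv zetaPole s = riemannZeta s + (s - 1) * deriv riemannZeta s := by
    have h1 : zetaPole =ᶠ[nhds s] fun z => (z - 1) * riemannZeta z := by
      filter_upwards [eventually_ne_nhds hs1] with z hz using zetaPole_of_ne hz
    rw [h1.deriv_eq]
    have h2 := ((hasDerivAt_id s).sub_const 1).mul (differentiableAt_riemannZeta hs1).hasDerivAt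
    refine h2.deriv.trans ?_
    simp
  rw [LSeries_vonMangoldtSubOne hs, dslope_of_ne _ hs1, slope_def_field, hd, zetaPole_one,
    zetaPole_of_ne hs1]
  field_simp
  ring

lemma exists_norm_LSeries_logSqDeviation_le_of_abs_im_le : ∃ C : ℝ, ∀ s : ℂ, 1 < s.re →
    s.re ≤ 2 → |s.im| ≤ 2 → ‖LSeries (fun n => (logSqDeviation n : ℂ)) s‖ ≤ C := by
  set K : ℂ → ℂ := fun s => -(deriv zetaPole s / zetaPole s) - dslope zetaPole 1 s with hK
  have hopen : IsOpen {z : ℂ | zetaPole z ≠ 0} :=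
    isOpen_ne_fun differentiable_zetaPole.continuous continuous_const
  have hdiff : DifferentiableOn ℂ K {z : ℂ | zetaPole z ≠ 0} := by
    refine DifferentiableOn.sub (DifferentiableOn.neg (DifferentiableOn.div ?_ ?_
      fun z hz => hz)) ?_
    · exact (differentiable_zetaPole.deriv).differentiableOn
    · exact differentiable_zetaPole.differentiableOn
    · have := (Complex.differentiableOn_dslope (f := zetaPole) (c := 1) Filter.univ_mem).2
        differentiable_zetaPole.differentiableOn
      exact this.mono (Set.subset_univ _)
  have han := (hdiff.analyticOnNhd hopen).iterated_deriv 2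
  have hsub : Set.Icc (1 : ℝ) 2 ×ℂ Set.Icc (-2 : ℝ) 2 ⊆ {z : ℂ | zetaPole z ≠ 0} := by
    intro z hz
    exact zetaPole_ne_zero (Complex.mem_reProdIm.1 hz).1.1
  obtain ⟨C, hC⟩ := (isCompact_Icc.reProdIm isCompact_Icc).exists_bound_of_continuousOn
    (han.continuousOn.mono hsub)
  refine ⟨C, fun s h1 h2 ht => ?_⟩
  have heq : LSeries vonMangoldtSubOne =ᶠ[nhds s] K := by
    filter_upwards [isOpen_one_lt_re.mem_nhds h1] with z hz
      using LSeries_vonMangoldtSubOne_eq_zetaPole hz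
  rw [LSeries_logSqDeviation h1, heq.iteratedDeriv_eq, iteratedDeriv_eq_iterate]
  exact hC s (Complex.mem_reProdIm.2 ⟨⟨h1.le, h2⟩, abs_le.1 ht⟩)

lemma hasDerivAt_iteratedDeriv_riemannZeta (k : ℕ) {s : ℂ} (hs : s ≠ 1) :
    HasDerivAt (iteratedDeriv k riemannZeta) (iteratedDeriv (k + 1) riemannZeta s) s := by
  have hd : DifferentiableOn ℂ riemannZeta {1}ᶜ := fun z hz =>
    (differentiableAt_riemannZeta hz).differentiableWithinAt
  have := (hd.analyticOnNhd isOpen_compl_singleton).iterated_deriv k s hs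
  rw [iteratedDeriv_succ, iteratedDeriv_eq_iterate]
  exact this.differentiableAt.hasDerivAt

lemma LSeries_logSqDeviation_eq {s : ℂ} (hs : 1 < s.re) :
    LSeries (fun n => (logSqDeviation n : ℂ)) s =
      -(iteratedDeriv 3 riemannZeta s * (riemannZeta s)⁻¹
        - 3 * iteratedDeriv 1 riemannZeta s * iteratedDeriv 2 riemannZeta s * (riemannZeta s)⁻¹ ^ 2
        + 2 * iteratedDeriv 1 riemannZeta s ^ 3 * (riemannZeta s)⁻¹ ^ 3)
      - iteratedDeriv 2 riemannZeta s := by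
  have hne : ∀ z : ℂ, 1 < z.re → z ≠ 1 := by rintro z hz rfl; simp at hz
  have hd : ∀ z : ℂ, 1 < z.re → ∀ k, HasDerivAt (iteratedDeriv k riemannZeta)
      (iteratedDeriv (k + 1) riemannZeta z) z :=
    fun z hz k => hasDerivAt_iteratedDeriv_riemannZeta k (hne z hz)
  have h0 : ∀ z : ℂ, 1 < z.re → riemannZeta z ≠ 0 :=
    fun z hz => riemannZeta_ne_zero_of_one_lt_re hz
  have e0 : iteratedDeriv 0 riemannZeta = riemannZeta := iteratedDeriv_zero
  have first : ∀ z : ℂ, 1 < z.re → deriv (LSeries vonMangoldtSubOne) z =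
      -((iteratedDeriv 2 riemannZeta z * riemannZeta z
        - iteratedDeriv 1 riemannZeta z * iteratedDeriv 1 riemannZeta z) / riemannZeta z ^ 2)
        - iteratedDeriv 1 riemannZeta z := by
    intro z hz
    have heq : LSeries vonMangoldtSubOne =ᶠ[nhds z]
        fun w => -(iteratedDeriv 1 riemannZeta w / riemannZeta w) - riemannZeta w := by
      filter_upwards [isOpen_one_lt_re.mem_nhds hz] with w hw
      rw [LSeries_vonMangoldtSubOne hw, iteratedDeriv_one]
    rw [heq.deriv_eq]
    have d0 := hd z hz 0
    rw [e0] at d0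
    exact (((hd z hz 1).div d0 (h0 z hz)).neg.sub d0).deriv
  rw [LSeries_logSqDeviation hs, iteratedDeriv_succ, iteratedDeriv_one]
  have heq : deriv (LSeries vonMangoldtSubOne) =ᶠ[nhds s] fun z =>
      -((iteratedDeriv 2 riemannZeta z * riemannZeta z
        - iteratedDeriv 1 riemannZeta z * iteratedDeriv 1 riemannZeta z) / riemannZeta z ^ 2)
        - iteratedDeriv 1 riemannZeta z := by
    filter_upwards [isOpen_one_lt_re.mem_nhds hs] with z hz using first z hz
  rw [heq.deriv_eq]
  have d0 := hd s hs 0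
  rw [e0] at d0
  have d1 := hd s hs 1
  have d2 := hd s hs 2
  have := ((((d2.mul d0).sub (d1.mul d1)).div (d0.pow 2)
    (pow_ne_zero 2 (h0 s hs))).neg.sub d1).deriv
  refine this.trans ?_
  have hz := h0 s hs
  simp only [Pi.sub_apply, Pi.mul_apply, Pi.pow_apply, zero_add, Nat.reduceAdd]
  field_simp
  ring

lemma exists_norm_LSeries_logSqDeviation_le : ∃ C : ℝ, 0 ≤ C ∧ ∀ s : ℂ, 1 < s.re →
    s.re ≤ 2 → ‖LSeries (fun n => (logSqDeviation n : ℂ)) s‖ ≤ C * (1 + |s.im|) ^ (1 / 2 : ℝ) := by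
  obtain ⟨C₁, hC₁⟩ := exists_norm_LSeries_logSqDeviation_le_of_abs_im_le
  obtain ⟨C, hC, c, hc, hb⟩ := exists_le_norm_riemannZeta
  refine ⟨max (max C₁ ((1 / c + 3 / c ^ 2 + 2 / c ^ 3 + 1) * C ^ 15)) 0, le_max_right _ _,
    fun s h1 h2 => ?_⟩
  rcases le_total |s.im| 2 with ht | ht
  · have hle : C₁ ≤ max (max C₁ ((1 / c + 3 / c ^ 2 + 2 / c ^ 3 + 1) * C ^ 15)) 0 :=
      (le_max_left _ _).trans (le_max_left _ _)
    refine (hC₁ s h1 h2 ht).trans (hle.trans ?_)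
    exact le_mul_of_one_le_right (le_max_right _ _)
      (one_le_rpow (by linarith [abs_nonneg s.im]) (by norm_num))
  · obtain ⟨hder, hlow⟩ := hb s h1 h2 ht
    set M : ℝ := C * |s.im| ^ (1 / 30 : ℝ) with hM
    have hM1 : 1 ≤ M := one_le_mul_of_one_le_of_one_le hC
      (one_le_rpow (by linarith) (by norm_num))
    have hM0 : 0 < M := by linarith
    have hinv : ‖(riemannZeta s)⁻¹‖ ≤ M ^ 4 / c := by
      rw [norm_inv]
      calc ‖riemannZeta s‖⁻¹ ≤ (c / M ^ 4)⁻¹ := by gcongr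
        _ = M ^ 4 / c := inv_div _ _
    have d1 := hder 1 (by norm_num)
    have d2 := hder 2 (by norm_num)
    have d3 := hder 3 (by norm_num)
    rw [LSeries_logSqDeviation_eq h1]
    have hM15 : M ^ 15 = C ^ 15 * |s.im| ^ (1 / 2 : ℝ) := by
      rw [hM, mul_pow, ← rpow_natCast (|s.im| ^ (1 / 30 : ℝ)), ← rpow_mul (abs_nonneg _)]
      norm_num
    calc _ ≤ ‖iteratedDeriv 3 riemannZeta s‖ * ‖(riemannZeta s)⁻¹‖
        + 3 * ‖iteratedDeriv 1 riemannZeta s‖ * ‖iteratedDeriv 2 riemannZeta s‖ *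
          ‖(riemannZeta s)⁻¹‖ ^ 2
        + 2 * ‖iteratedDeriv 1 riemannZeta s‖ ^ 3 * ‖(riemannZeta s)⁻¹‖ ^ 3
        + ‖iteratedDeriv 2 riemannZeta s‖ := by
          refine (norm_sub_le _ _).trans ?_
          rw [norm_neg]
          gcongr
          refine (norm_add_le _ _).trans ?_
          gcongr
          · refine (norm_sub_le _ _).trans ?_
            simp [norm_pow]
          · simp [norm_pow]
      _ ≤ M * (M ^ 4 / c) + 3 * M * M * (M ^ 4 / c) ^ 2 + 2 * M ^ 3 * (M ^ 4 / c) ^ 3 + M := by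
          gcongr
      _ = 1 / c * M ^ 5 + 3 / c ^ 2 * M ^ 10 + 2 / c ^ 3 * M ^ 15 + 1 * M ^ 1 := by
          field_simp
      _ ≤ 1 / c * M ^ 15 + 3 / c ^ 2 * M ^ 15 + 2 / c ^ 3 * M ^ 15 + 1 * M ^ 15 := by
          gcongr <;> first | exact hM1 | norm_num
      _ = ((1 / c + 3 / c ^ 2 + 2 / c ^ 3 + 1) * C ^ 15) * |s.im| ^ (1 / 2 : ℝ) := by
          rw [hM15]; ring
      _ ≤ _ := by
          gcongr
          · exact le_trans (le_max_right _ _) (le_max_left _ _)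
          · linarith

/-- The truncated linear weight `u ↦ (1 - u)₊` on `(0, ∞)`. -/
noncomputable def cesaroWeight (u : ℝ) : ℂ :=
  Set.indicator (Set.Ioc (0 : ℝ) 1) (fun u : ℝ => 1 - (u : ℂ)) u

lemma hasMellin_cesaroWeight {s : ℂ} (hs : 0 < s.re) :
    HasMellin cesaroWeight s (1 / (s * (s + 1))) := by
  have h0 := hasMellin_one_Ioc hs
  have h1 := hasMellin_cpow_Ioc 1 (s := s) (by simp; linarith)
  have h := hasMellin_sub h0.1 h1.1
  rw [h0.2, h1.2] at h
  have e : (1 : ℂ) / s - 1 / (s + 1) = 1 / (s * (s + 1)) := by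
    have hs0 : s ≠ 0 := by rintro rfl; simp at hs
    have hs1 : s + 1 ≠ 0 := by
      intro h
      have := congrArg Complex.re h
      simp at this
      linarith
    field_simp
    ring
  rw [e] at h
  have hw : cesaroWeight = fun u : ℝ => Set.indicator (Set.Ioc (0 : ℝ) 1) (fun _ => (1 : ℂ)) u -
      Set.indicator (Set.Ioc (0 : ℝ) 1) (fun u : ℝ => (u : ℂ) ^ (1 : ℂ)) u := by
    funext u
    by_cases hu : u ∈ Set.Ioc (0 : ℝ) 1 <;> simp [cesaroWeight, hu]
  rw [hw]
  exact h

lemma cesaroWeight_of_pos {u : ℝ} (hu : 0 < u) :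
    cesaroWeight u = ((max (1 - u) 0 : ℝ) : ℂ) := by
  rcases le_total u 1 with h | h
  · rw [cesaroWeight, Set.indicator_of_mem (Set.mem_Ioc.2 ⟨hu, h⟩), max_eq_left (by linarith)]
    push_cast
    rfl
  · rw [max_eq_right (by linarith)]
    rcases h.eq_or_lt with rfl | h
    · simp [cesaroWeight]
    · rw [cesaroWeight, Set.indicator_of_notMem fun h' => h.not_ge h'.2]
      simp

lemma continuousAt_cesaroWeight {u : ℝ} (hu : 0 < u) : ContinuousAt cesaroWeight u := by
  have h : (fun u : ℝ => ((max (1 - u) 0 : ℝ) : ℂ)) =ᶠ[nhds u] cesaroWeight := by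
    filter_upwards [lt_mem_nhds hu] with v hv using (cesaroWeight_of_pos hv).symm
  exact ContinuousAt.congr (by fun_prop) h

lemma norm_one_div_mul_add_one_le {σ : ℝ} (hσ : 1 ≤ σ) (t : ℝ) :
    ‖1 / (((σ : ℂ) + t * Complex.I) * ((σ : ℂ) + t * Complex.I + 1))‖ ≤ (1 + t ^ 2)⁻¹ := by
  have h : ∀ r : ℝ, 1 ≤ r → √(1 + t ^ 2) ≤ ‖(r : ℂ) + t * Complex.I‖ := by
    intro r hr
    rw [Complex.norm_add_mul_I]
    gcongr
    nlinarith
  rw [one_div, norm_inv, norm_mul]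
  gcongr
  calc 1 + t ^ 2 = √(1 + t ^ 2) * √(1 + t ^ 2) := (mul_self_sqrt (by positivity)).symm
    _ ≤ _ := by
      gcongr
      · exact h σ hσ
      · have := h (σ + 1) (by linarith)
        push_cast at this
        rwa [add_right_comm] at this

lemma continuous_one_div_mul_add_one {σ : ℝ} (hσ : 1 ≤ σ) :
    Continuous fun t : ℝ =>
      1 / (((σ : ℂ) + t * Complex.I) * ((σ : ℂ) + t * Complex.I + 1)) := by
  refine Continuous.div₀ continuous_const (by fun_prop) fun t => ?_
  refine mul_ne_zero ?_ ?_ <;> intro h <;> have := congrArg Complex.re h <;> simp at this <;>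
    linarith

lemma integrable_one_div_mul_add_one {σ : ℝ} (hσ : 1 ≤ σ) :
    MeasureTheory.Integrable fun t : ℝ =>
      1 / (((σ : ℂ) + t * Complex.I) * ((σ : ℂ) + t * Complex.I + 1)) :=
  integrable_inv_one_add_sq.mono' (continuous_one_div_mul_add_one hσ).aestronglyMeasurable
    (Filter.Eventually.of_forall (norm_one_div_mul_add_one_le hσ))

lemma integral_cpow_mul_one_div_mul_add_one {σ : ℝ} (hσ : 1 ≤ σ) {u : ℝ} (hu : 0 < u) :
    ∫ t : ℝ, (u : ℂ) ^ (-((σ : ℂ) + t * Complex.I)) *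
      (1 / (((σ : ℂ) + t * Complex.I) * ((σ : ℂ) + t * Complex.I + 1))) =
      2 * π * cesaroWeight u := by
  have hre : ∀ t : ℝ, 0 < ((σ : ℂ) + t * Complex.I).re := fun t => by simp; linarith
  have hm : ∀ t : ℝ, mellin cesaroWeight ((σ : ℂ) + t * Complex.I) =
      1 / (((σ : ℂ) + t * Complex.I) * ((σ : ℂ) + t * Complex.I + 1)) :=
    fun t => (hasMellin_cesaroWeight (hre t)).2
  have h := mellinInv_mellin_eq σ cesaroWeight hu
    (hasMellin_cesaroWeight (by simpa using by linarith)).1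
    (by simpa only [Complex.VerticalIntegrable, hm] using integrable_one_div_mul_add_one hσ)
    (continuousAt_cesaroWeight hu)
  simp only [mellinInv, hm, smul_eq_mul] at h
  have hpi : (π : ℂ) ≠ 0 := by exact_mod_cast pi_ne_zero
  rw [← h, Complex.real_smul, ← mul_assoc]
  push_cast
  rw [mul_one_div_cancel (by simp), one_mul]

lemma integrable_rpow_mul_inv_one_add_sq :
    MeasureTheory.Integrable fun t : ℝ => (1 + |t|) ^ (1 / 2 : ℝ) * (1 + t ^ 2)⁻¹ := by
  have h := (integrable_one_add_norm (E := ℝ) (μ := MeasureTheory.volume) (r := 3 / 2)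
    (by norm_num)).const_mul 2
  refine h.mono' (Continuous.aestronglyMeasurable ?_) (Filter.Eventually.of_forall fun t => ?_)
  · refine Continuous.mul ?_ (Continuous.inv₀ (by fun_prop) fun t => by positivity)
    exact Continuous.rpow_const (by fun_prop) fun t => Or.inr (by norm_num)
  · rw [norm_of_nonneg (by positivity), norm_eq_abs]
    have hp : 0 < 1 + |t| := by positivity
    have e : (1 + |t|) ^ (1 / 2 : ℝ) = (1 + |t|) ^ (-(3 / 2) : ℝ) * (1 + |t|) ^ 2 := by
      rw [← rpow_natCast, ← rpow_add hp]
      norm_num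
    rw [e, ← div_eq_mul_inv, div_le_iff₀ (by positivity)]
    have : (1 + |t|) ^ 2 ≤ 2 * (1 + t ^ 2) := by nlinarith [sq_abs t, sq_nonneg (1 - |t|)]
    nlinarith [rpow_nonneg hp.le (-(3 / 2) : ℝ)]

lemma LSeries_term_mul_cpow {a : ℕ → ℂ} {s : ℂ} {n : ℕ} (hn : n ≠ 0) {x : ℝ} (hx : 0 < x) :
    LSeries.term a s n * (x : ℂ) ^ s = a n * ((n / x : ℝ) : ℂ) ^ (-s) := by
  rw [LSeries.term_of_ne_zero hn, Complex.ofReal_div, Complex.cpow_neg, div_eq_mul_inv]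
  have h := Complex.mul_cpow_ofReal_nonneg (a := n / x) (b := x) (by positivity) hx.le s
  have e : ((n / x : ℝ) : ℂ) * (x : ℂ) = (n : ℂ) := by
    push_cast
    exact div_mul_cancel₀ _ (by exact_mod_cast hx.ne')
  rw [e] at h
  rw [h, mul_inv]
  have hx' : (x : ℂ) ^ s ≠ 0 := by
    rw [Complex.cpow_ne_zero_iff]
    left
    exact_mod_cast hx.ne'
  push_cast
  field_simp

/-- A bound for Cesàro sums of a sequence in terms of its Dirichlet series on a vertical line. -/
lemma norm_sum_mul_one_sub_div_le {a : ℕ → ℂ} (ha : a 0 = 0) {σ : ℝ} (hσ : 1 ≤ σ)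
    (hs : LSeriesSummable a σ) {C : ℝ}
    (hC : ∀ t : ℝ, ‖LSeries a ((σ : ℂ) + t * Complex.I)‖ ≤ C * (1 + |t|) ^ (1 / 2 : ℝ))
    {N : ℕ} (hN : 0 < N) :
    ‖∑ n ∈ Finset.range N, a n * (1 - n / N)‖ ≤
      (2 * π)⁻¹ * (C * (N : ℝ) ^ σ *
        ∫ t : ℝ, (1 + |t|) ^ (1 / 2 : ℝ) * (1 + t ^ 2)⁻¹) := by
  have hx : (0 : ℝ) < N := by exact_mod_cast hN
  set k : ℝ → ℂ := fun t =>
    1 / (((σ : ℂ) + t * Complex.I) * ((σ : ℂ) + t * Complex.I + 1)) with hk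
  set F : ℕ → ℝ → ℂ := fun n t =>
    LSeries.term a ((σ : ℂ) + t * Complex.I) n *
      (((N : ℝ) : ℂ) ^ ((σ : ℂ) + t * Complex.I) * k t) with hF
  have hre : ∀ t : ℝ, ((σ : ℂ) + t * Complex.I).re = σ := fun t => by simp
  have hnx : ∀ t : ℝ, ‖((N : ℝ) : ℂ) ^ ((σ : ℂ) + t * Complex.I)‖ = (N : ℝ) ^ σ := fun t => by
    rw [Complex.norm_cpow_eq_rpow_re_of_pos hx, hre]
  have hterm : ∀ n (t : ℝ), ‖LSeries.term a ((σ : ℂ) + t * Complex.I) n‖ = ‖LSeries.term a σ n‖ :=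
    fun n t => by simp [LSeries.norm_term_eq]
  have hnF : ∀ n t, ‖F n t‖ = ‖LSeries.term a σ n‖ * (N : ℝ) ^ σ * ‖k t‖ := fun n t => by
    simp only [hF]
    rw [norm_mul, norm_mul, hnx, hterm, mul_assoc]
  have hcont : ∀ n, Continuous (F n) := by
    intro n
    refine Continuous.mul ?_ (Continuous.mul ?_ (continuous_one_div_mul_add_one hσ))
    · rcases eq_or_ne n 0 with rfl | hn
      · simp only [LSeries.term_zero]
        exact continuous_const
      · simp only [LSeries.term_of_ne_zero hn]
        refine Continuous.div₀ continuous_const ?_ fun t => ?_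
        · exact Continuous.const_cpow (by fun_prop) (Or.inl (by exact_mod_cast hn))
        · rw [Complex.cpow_ne_zero_iff]
          exact Or.inl (by exact_mod_cast hn)
    · exact Continuous.const_cpow (by fun_prop) (Or.inl (by exact_mod_cast hN.ne'))
  have hFint : ∀ n, MeasureTheory.Integrable (F n) := fun n =>
    ((integrable_one_div_mul_add_one hσ).norm.const_mul
      (‖LSeries.term a σ n‖ * (N : ℝ) ^ σ)).mono' (hcont n).aestronglyMeasurable
      (Filter.Eventually.of_forall fun t => (hnF n t).le)
  have hsum : Summable fun n => ∫ t, ‖F n t‖ := by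
    simp only [hnF, MeasureTheory.integral_const_mul, mul_assoc]
    exact hs.norm.mul_right _
  have hval : ∀ n, ∫ t, F n t = 2 * π * (a n * cesaroWeight (n / N)) := by
    intro n
    rcases eq_or_ne n 0 with rfl | hn
    · simp [hF, ha]
    · have hn' : (0 : ℝ) < n := by exact_mod_cast Nat.pos_of_ne_zero hn
      have e : F n = fun t : ℝ => a n * (((n / N : ℝ) : ℂ) ^ (-((σ : ℂ) + t * Complex.I)) *
          (1 / (((σ : ℂ) + t * Complex.I) * ((σ : ℂ) + t * Complex.I + 1)))) := by
        ext t
        simp only [hF, hk]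
        rw [← mul_assoc, LSeries_term_mul_cpow hn hx, mul_assoc]
      rw [e, MeasureTheory.integral_const_mul,
        integral_cpow_mul_one_div_mul_add_one hσ (by positivity)]
      ring
  have h := (MeasureTheory.hasSum_integral_of_summable_integral_norm hFint hsum).tsum_eq
  simp only [hval] at h
  rw [tsum_eq_sum (s := Finset.range N)] at h
  swap
  · intro n hn
    have hn : (N : ℝ) ≤ n := by exact_mod_cast not_lt.1 (fun h => hn (Finset.mem_range.2 h))
    have h1 : 1 ≤ (n : ℝ) / N := (one_le_div hx).2 hn
    rw [cesaroWeight_of_pos (by linarith), max_eq_right (by linarith)]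
    simp
  have hsumeq : ∑ n ∈ Finset.range N, 2 * π * (a n * cesaroWeight (n / N)) =
      2 * π * ∑ n ∈ Finset.range N, a n * (1 - n / N) := by
    rw [Finset.mul_sum]
    refine Finset.sum_congr rfl fun n hn => ?_
    rcases eq_or_ne n 0 with rfl | hn0
    · simp [ha]
    · have hn' : (0 : ℝ) < n := by exact_mod_cast Nat.pos_of_ne_zero hn0
      have hnN : (n : ℝ) < N := by exact_mod_cast Finset.mem_range.1 hn
      have h1 : (n : ℝ) / N < 1 := (div_lt_one hx).2 hnN
      rw [cesaroWeight_of_pos (by positivity), max_eq_left (by linarith)]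
      push_cast
      rfl
  rw [hsumeq] at h
  have hbound : ‖∫ t, ∑' n, F n t‖ ≤ ∫ t : ℝ, C * (N : ℝ) ^ σ *
      ((1 + |t|) ^ (1 / 2 : ℝ) * (1 + t ^ 2)⁻¹) := by
    refine MeasureTheory.norm_integral_le_of_norm_le
      (integrable_rpow_mul_inv_one_add_sq.const_mul _) (Filter.Eventually.of_forall fun t => ?_)
    have e : ∑' n, F n t = LSeries a ((σ : ℂ) + t * Complex.I) *
        (((N : ℝ) : ℂ) ^ ((σ : ℂ) + t * Complex.I) * k t) := tsum_mul_right
    rw [e, norm_mul, norm_mul, hnx]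
    calc _ ≤ C * (1 + |t|) ^ (1 / 2 : ℝ) * ((N : ℝ) ^ σ * (1 + t ^ 2)⁻¹) := by
          gcongr
          · exact (norm_nonneg _).trans (hC t)
          · exact hC t
          · exact norm_one_div_mul_add_one_le hσ t
      _ = _ := by ring
  rw [← h, norm_mul, MeasureTheory.integral_const_mul] at hbound
  have h2 : ‖(2 * π : ℂ)‖ = 2 * π := by
    rw [norm_mul, Complex.norm_real, norm_of_nonneg pi_pos.le]
    simp
  rw [h2] at hbound
  rw [inv_mul_eq_div, le_div_iff₀ (by positivity), mul_comm]
  exact hbound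

/-- Cesàro sums of `(Λ(n) - 1) log² n` are bounded: this carries the information from the
`3-4-1` zero-free line. -/
lemma exists_abs_sum_logSqDeviation_mul_sub_le : ∃ C : ℝ, 0 ≤ C ∧ ∀ N : ℕ, 3 ≤ N →
    |∑ n ∈ Finset.range N, logSqDeviation n * ((N : ℝ) - n)| ≤ C * (N : ℝ) ^ 2 := by
  obtain ⟨C, hC0, hC⟩ := exists_norm_LSeries_logSqDeviation_le
  set I : ℝ := ∫ t : ℝ, (1 + |t|) ^ (1 / 2 : ℝ) * (1 + t ^ 2)⁻¹ with hI
  have hI0 : 0 ≤ I := MeasureTheory.integral_nonneg fun t => by positivity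
  refine ⟨(2 * π)⁻¹ * (C * exp 1 * I), by positivity, fun N hN => ?_⟩
  have hNreal : (3 : ℝ) ≤ N := by exact_mod_cast hN
  have hlog : 1 ≤ log N := by
    rw [le_log_iff_exp_le (by linarith)]
    exact (exp_one_lt_d9.le.trans (by norm_num)).trans hNreal
  set σ : ℝ := 1 + 1 / log N with hσ
  have hσ1 : 1 < σ := by rw [hσ]; linarith [show 0 < 1 / log N by positivity]
  have hσ2 : σ ≤ 2 := by
    have : 1 / log N ≤ 1 := by rw [div_le_one (by linarith)]; exact hlog
    linarith
  have hpow : (N : ℝ) ^ σ = exp 1 * N := by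
    rw [hσ, rpow_add (by linarith), rpow_one, one_div, rpow_inv_log (by linarith) (by linarith)]
    ring
  have h := norm_sum_mul_one_sub_div_le (a := fun n => (logSqDeviation n : ℂ))
    (by simp [logSqDeviation]) hσ1.le
    (LSeriesSummable_logSqDeviation (by simpa using hσ1)) (C := C)
    (fun t => by simpa using hC ((σ : ℂ) + t * Complex.I) (by simpa using hσ1) (by simpa using hσ2))
    (show 0 < N by omega)
  rw [hpow] at h
  have e : ∑ n ∈ Finset.range N, logSqDeviation n * ((N : ℝ) - n) =
      N * ∑ n ∈ Finset.range N, logSqDeviation n * (1 - n / N) := by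
    rw [Finset.mul_sum]
    refine Finset.sum_congr rfl fun n _ => ?_
    field_simp
  have e2 : ‖∑ n ∈ Finset.range N, (logSqDeviation n : ℂ) * (1 - n / N)‖ =
      |∑ n ∈ Finset.range N, logSqDeviation n * (1 - n / N)| := by
    rw [← norm_eq_abs, ← Complex.norm_real]
    push_cast
    rfl
  rw [e2] at h
  rw [e, abs_mul, abs_of_nonneg (by linarith : (0 : ℝ) ≤ N)]
  calc _ ≤ (N : ℝ) * ((2 * π)⁻¹ * (C * (exp 1 * N) * I)) := by gcongr
    _ = _ := by ring

lemma neg_log_sq_le_logSqDeviation (n : ℕ) : -log n ^ 2 ≤ logSqDeviation n := by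
  have : 0 ≤ ArithmeticFunction.vonMangoldt n := ArithmeticFunction.vonMangoldt_nonneg
  rw [logSqDeviation]
  nlinarith [mul_nonneg this (sq_nonneg (log n))]

lemma sum_range_mul_sub_sub_left (b : ℕ → ℝ) {M K : ℕ} (h : M ≤ K) :
    ∑ n ∈ Finset.range K, b n * ((K : ℝ) - n) - ∑ n ∈ Finset.range M, b n * ((M : ℝ) - n) =
      ((K : ℝ) - M) * ∑ n ∈ Finset.range M, b n + ∑ n ∈ Finset.Ico M K, b n * ((K : ℝ) - n) := by
  rw [← Finset.sum_range_add_sum_Ico _ h, Finset.mul_sum, add_sub_right_comm,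
    ← Finset.sum_sub_distrib]
  congr 1
  exact Finset.sum_congr rfl fun n _ => by ring

lemma sum_range_mul_sub_sub_right (b : ℕ → ℝ) {M K : ℕ} (h : M ≤ K) :
    ∑ n ∈ Finset.range K, b n * ((K : ℝ) - n) - ∑ n ∈ Finset.range M, b n * ((M : ℝ) - n) =
      ((K : ℝ) - M) * ∑ n ∈ Finset.range K, b n - ∑ n ∈ Finset.Ico M K, b n * ((n : ℝ) - M) := by
  rw [sum_range_mul_sub_sub_left b h, ← Finset.sum_range_add_sum_Ico b h, mul_add, add_sub_assoc,
    Finset.mul_sum (Finset.Ico M K), ← Finset.sum_sub_distrib]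
  congr 1
  exact Finset.sum_congr rfl fun n _ => by ring

lemma neg_le_sum_Ico_logSqDeviation_mul {M K : ℕ} (hMK : M ≤ K) {w : ℕ → ℝ}
    (h0 : ∀ n ∈ Finset.Ico M K, 0 ≤ w n) (h1 : ∀ n ∈ Finset.Ico M K, w n ≤ (K : ℝ) - M) :
    -(((K : ℝ) - M) ^ 2 * log K ^ 2) ≤ ∑ n ∈ Finset.Ico M K, logSqDeviation n * w n := by
  have h : ∀ n ∈ Finset.Ico M K, -(((K : ℝ) - M) * log K ^ 2) ≤ logSqDeviation n * w n := by
    intro n hn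
    have hlog : log n ^ 2 ≤ log K ^ 2 := by
      rcases Nat.eq_zero_or_pos n with rfl | hpos
      · simp [sq_nonneg]
      · have hn1 : (1 : ℝ) ≤ n := by exact_mod_cast hpos
        have hnK : (n : ℝ) ≤ K := by exact_mod_cast (Finset.mem_Ico.1 hn).2.le
        have := log_nonneg hn1
        gcongr
    calc -(((K : ℝ) - M) * log K ^ 2) ≤ -(w n * log n ^ 2) := by
          gcongr
          · exact (h0 n hn).trans (h1 n hn)
          · exact h1 n hn
      _ = -log n ^ 2 * w n := by ring
      _ ≤ _ := by
          gcongr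
          · exact h0 n hn
          · exact neg_log_sq_le_logSqDeviation n
  calc -(((K : ℝ) - M) ^ 2 * log K ^ 2)
      = ∑ n ∈ Finset.Ico M K, -(((K : ℝ) - M) * log K ^ 2) := by
        rw [Finset.sum_const, Nat.card_Ico, nsmul_eq_mul, Nat.cast_sub hMK]
        ring
    _ ≤ _ := Finset.sum_le_sum h

lemma one_le_log_natCast {N : ℕ} (hN : 3 ≤ N) : 1 ≤ log N := by
  have hN' : (3 : ℝ) ≤ N := by exact_mod_cast hN
  rw [le_log_iff_exp_le (by linarith)]
  exact (exp_one_lt_d9.le.trans (by norm_num)).trans hN'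

/-- Removing the Cesàro weight by a Tauberian argument, using `(Λ(n) - 1) log² n ≥ - log² n`. -/
lemma exists_abs_sum_logSqDeviation_le : ∃ C : ℝ, 0 ≤ C ∧ ∀ N : ℕ, 3 ≤ N →
    |∑ n ∈ Finset.range N, logSqDeviation n| ≤ C * (N * log N) := by
  obtain ⟨C, hC0, hC3⟩ := exists_abs_sum_logSqDeviation_mul_sub_le
  have hC : ∀ N : ℕ,
      |∑ n ∈ Finset.range N, logSqDeviation n * ((N : ℝ) - n)| ≤ C * (N : ℝ) ^ 2 := by
    intro N
    rcases le_or_gt 3 N with h | h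
    · exact hC3 N h
    · have : ∑ n ∈ Finset.range N, logSqDeviation n * ((N : ℝ) - n) = 0 := by
        interval_cases N <;> simp [Finset.sum_range_succ, logSqDeviation]
      rw [this, abs_zero]
      positivity
  refine ⟨5 * C + 8, by positivity, fun N hN => ?_⟩
  have hN0 : (3 : ℝ) ≤ N := by exact_mod_cast hN
  have hlog := one_le_log_natCast hN
  set h : ℕ := ⌈(N : ℝ) / log N⌉₊ with hh
  have hle : (N : ℝ) / log N ≤ h := Nat.le_ceil _
  have hhN : h ≤ N := Nat.ceil_le.2 (div_le_self (by linarith) hlog)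
  have hhN' : (h : ℝ) ≤ N := by exact_mod_cast hhN
  have h1 : 1 ≤ (N : ℝ) / log N := by
    rw [one_le_div (by linarith)]
    linarith [log_le_sub_one_of_pos (show (0 : ℝ) < N by linarith)]
  have hpos : (0 : ℝ) < h := by linarith
  have hup : (h : ℝ) ≤ 2 * (N / log N) := by
    have := Nat.ceil_lt_add_one (show 0 ≤ (N : ℝ) / log N by linarith)
    rw [← hh] at this
    linarith
  have hsq : (N : ℝ) ^ 2 ≤ h * (N * log N) := by
    calc (N : ℝ) ^ 2 = N / log N * (N * log N) := by field_simp
      _ ≤ _ := by gcongr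
  have hsq2 : (h : ℝ) ^ 2 * log N ^ 2 ≤ h * (2 * (N * log N)) := by
    calc (h : ℝ) ^ 2 * log N ^ 2 = h * (h * log N ^ 2) := by ring
      _ ≤ h * (2 * (N / log N) * log N ^ 2) := by gcongr
      _ = _ := by field_simp
  rw [abs_le]
  constructor
  · have key := sum_range_mul_sub_sub_right logSqDeviation (Nat.sub_le N h)
    have hcast : ((N - h : ℕ) : ℝ) = N - h := Nat.cast_sub hhN
    have hneg := neg_le_sum_Ico_logSqDeviation_mul (Nat.sub_le N h)
      (w := fun n => (n : ℝ) - (N - h : ℕ))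
      (fun n hn => sub_nonneg.2 (by exact_mod_cast (Finset.mem_Ico.1 hn).1))
      (fun n hn => sub_le_sub_right (by exact_mod_cast (Finset.mem_Ico.1 hn).2.le) _)
    have a1 := (abs_le.1 (hC N)).1
    have a2 := (abs_le.1 (hC (N - h))).2
    have hsub : (N : ℝ) - (N - h : ℕ) = h := by rw [hcast]; ring
    rw [hsub] at key hneg
    have a3 : C * ((N - h : ℕ) : ℝ) ^ 2 ≤ C * (N : ℝ) ^ 2 := by
      gcongr
      exact Nat.sub_le N h
    have a4 := mul_le_mul_of_nonneg_left hsq hC0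
    refine le_of_mul_le_mul_left ?_ hpos
    have a5 : 0 ≤ C * (h * (N * log N)) := by positivity
    have a6 : 0 ≤ h * (N * log N) := by positivity
    nlinarith
  · have key := sum_range_mul_sub_sub_left logSqDeviation (Nat.le_add_right N h)
    have hneg := neg_le_sum_Ico_logSqDeviation_mul (Nat.le_add_right N h)
      (w := fun n => ((N + h : ℕ) : ℝ) - n)
      (fun n hn => sub_nonneg.2 (by exact_mod_cast (Finset.mem_Ico.1 hn).2.le))
      (fun n hn => sub_le_sub_left (by exact_mod_cast (Finset.mem_Ico.1 hn).1) _)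
    have a1 := (abs_le.1 (hC N)).1
    have a2 := (abs_le.1 (hC (N + h))).2
    have hsub : ((N + h : ℕ) : ℝ) - N = h := by push_cast; ring
    rw [hsub] at key hneg
    have a3 : C * ((N + h : ℕ) : ℝ) ^ 2 ≤ C * (2 * (N : ℝ)) ^ 2 := by
      gcongr
      push_cast
      linarith
    have hlog2 : log ((N + h : ℕ) : ℝ) ≤ 2 * log N := by
      have : log ((N : ℝ) * N) = 2 * log N := by rw [log_mul (by linarith) (by linarith)]; ring
      rw [← this]
      refine log_le_log (by positivity) ?_
      push_cast
      nlinarith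
    have a7 : (h : ℝ) ^ 2 * log ((N + h : ℕ) : ℝ) ^ 2 ≤ (h : ℝ) ^ 2 * (2 * log N) ^ 2 := by
      have : 0 ≤ log ((N + h : ℕ) : ℝ) := log_natCast_nonneg _
      gcongr
    have a4 := mul_le_mul_of_nonneg_left hsq hC0
    refine le_of_mul_le_mul_left ?_ hpos
    nlinarith

lemma inv_log_sq_le_sub {N : ℕ} (hN : 8 ≤ N) :
    1 / log N ^ 2 ≤ 2 * ((N + 1 : ℕ) / log (N + 1 : ℕ) - N / log N) := by
  have hN0 : (8 : ℝ) ≤ N := by exact_mod_cast hN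
  have hlog : 2 ≤ log N := by
    have h8 : log 8 = 3 * log 2 := by
      rw [show (8 : ℝ) = 2 ^ 3 by norm_num, log_pow]; norm_num
    have := log_le_log (by norm_num) hN0
    linarith [log_two_gt_d9]
  have hup : log (N + 1 : ℕ) ≤ log N + 1 / N := by
    have : ((N + 1 : ℕ) : ℝ) = N * (1 + 1 / N) := by push_cast; field_simp
    rw [this, log_mul (by linarith) (by positivity)]
    linarith [log_le_sub_one_of_pos (show (0 : ℝ) < 1 + 1 / N by positivity)]
  have hlogpos : 0 < log (N + 1 : ℕ) := log_pos (by push_cast; linarith)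
  have h1 : ((N + 1 : ℕ) : ℝ) / (log N + 1 / N) ≤ (N + 1 : ℕ) / log (N + 1 : ℕ) := by gcongr
  have h2 : ((N + 1 : ℕ) : ℝ) / (log N + 1 / N) - N / log N =
      (log N - 1) / (log N * (log N + 1 / N)) := by
    have : log N + 1 / N ≠ 0 := by positivity
    push_cast
    field_simp
    ring
  have h3 : 1 / (2 * log N ^ 2) ≤ (log N - 1) / (log N * (log N + 1 / N)) := by
    have : (1 : ℝ) / N ≤ 1 := by rw [div_le_one (by linarith)]; linarith
    apply div_le_div₀ <;> first | linarith | positivity | nlinarith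
  have h4 : 1 / log N ^ 2 = 2 * (1 / (2 * log N ^ 2)) := by field_simp
  rw [h4]
  linarith

lemma inv_log_sq_sub_inv_log_sq_le {N : ℕ} (hN : 3 ≤ N) :
    ((N + 1 : ℕ) : ℝ) * log (N + 1 : ℕ) * (1 / log N ^ 2 - 1 / log (N + 1 : ℕ) ^ 2) ≤
      4 / log N ^ 2 := by
  have hN0 : (3 : ℝ) ≤ N := by exact_mod_cast hN
  have hlog := one_le_log_natCast hN
  set a := log N with ha
  set b := log (N + 1 : ℕ) with hb
  have hab : a ≤ b := log_le_log (by linarith) (by push_cast; linarith)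
  have hup : b ≤ a + 1 / N := by
    have : ((N + 1 : ℕ) : ℝ) = N * (1 + 1 / N) := by push_cast; field_simp
    rw [hb, this, log_mul (by linarith) (by positivity)]
    linarith [log_le_sub_one_of_pos (show (0 : ℝ) < 1 + 1 / N by positivity)]
  have hb0 : 0 < b := by linarith
  have ha0 : 0 < a := by linarith
  have e : ((N + 1 : ℕ) : ℝ) * b * (1 / a ^ 2 - 1 / b ^ 2) =
      ((N + 1 : ℕ) : ℝ) * (b - a) * (b + a) / (a ^ 2 * b) := by
    field_simp
    ring
  have h1 : ((N + 1 : ℕ) : ℝ) * (b - a) ≤ 2 := by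
    calc ((N + 1 : ℕ) : ℝ) * (b - a) ≤ (2 * N) * (1 / N) := by
          gcongr
          · push_cast
            linarith
          · linarith
      _ = 2 := by field_simp
  rw [e, div_le_div_iff₀ (by positivity) (by positivity)]
  calc ((N + 1 : ℕ) : ℝ) * (b - a) * (b + a) * a ^ 2 ≤ 2 * (b + b) * a ^ 2 := by gcongr
    _ = _ := by ring

lemma exists_abs_sum_vonMangoldt_sub_one_le : ∃ C : ℝ, 0 ≤ C ∧ ∀ N : ℕ, 8 ≤ N →
    |∑ n ∈ Finset.range N, (ArithmeticFunction.vonMangoldt n - 1)| ≤ C * (N / log N) := by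
  obtain ⟨C, hC0, hC⟩ := exists_abs_sum_logSqDeviation_le
  set S : ℕ → ℝ := fun N => ∑ n ∈ Finset.range N, logSqDeviation n with hS
  set U : ℕ → ℝ := fun N => ∑ n ∈ Finset.range N, (ArithmeticFunction.vonMangoldt n - 1)
    - S N * (1 / log N ^ 2) with hU
  have step : ∀ N : ℕ, 3 ≤ N →
      U (N + 1) - U N = S (N + 1) * (1 / log N ^ 2 - 1 / log (N + 1 : ℕ) ^ 2) := by
    intro N hN
    have hlog := one_le_log_natCast hN
    simp only [hU, hS, Finset.sum_range_succ, logSqDeviation]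
    field_simp
    ring
  have hind : ∀ N : ℕ, 8 ≤ N → |U N| ≤ |U 8| + 8 * C * (N / log N) := by
    intro N hN
    induction N, hN using Nat.le_induction with
    | base =>
      have : 0 < log ((8 : ℕ) : ℝ) := log_pos (by norm_num)
      have : 0 ≤ 8 * C * (((8 : ℕ) : ℝ) / log (8 : ℕ)) := by positivity
      linarith
    | succ N hN ih =>
      have hlog := one_le_log_natCast (show 3 ≤ N by omega)
      have hN0 : (8 : ℝ) ≤ N := by exact_mod_cast hN
      have h1 : |U (N + 1) - U N| ≤ 8 * C * ((N + 1 : ℕ) / log (N + 1 : ℕ) - N / log N) := by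
        have hnn : 0 ≤ 1 / log N ^ 2 - 1 / log (N + 1 : ℕ) ^ 2 := by
          rw [sub_nonneg]
          gcongr
          linarith
        rw [step N (by omega), abs_mul, abs_of_nonneg hnn]
        calc _ ≤ C * ((N + 1 : ℕ) * log (N + 1 : ℕ)) *
              (1 / log N ^ 2 - 1 / log (N + 1 : ℕ) ^ 2) := by
              gcongr
              exact hC _ (by omega)
          _ ≤ C * (4 / log N ^ 2) := by
              rw [mul_assoc]
              gcongr
              exact inv_log_sq_sub_inv_log_sq_le (by omega)
          _ = 4 * C * (1 / log N ^ 2) := by ring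
          _ ≤ 4 * C * (2 * ((N + 1 : ℕ) / log (N + 1 : ℕ) - N / log N)) := by
              gcongr
              exact inv_log_sq_le_sub hN
          _ = _ := by ring
      have h2 : |U (N + 1)| ≤ |U N| + |U (N + 1) - U N| := by
        simpa using abs_add_le (U N) (U (N + 1) - U N)
      linarith
  refine ⟨|U 8| + 8 * C + C, by positivity, fun N hN => ?_⟩
  have hlog := one_le_log_natCast (show 3 ≤ N by omega)
  have hN0 : (8 : ℝ) ≤ N := by exact_mod_cast hN
  have h1 : 1 ≤ (N : ℝ) / log N := by
    rw [one_le_div (by linarith)]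
    linarith [log_le_sub_one_of_pos (show (0 : ℝ) < N by linarith)]
  have hSN : |S N * (1 / log N ^ 2)| ≤ C * (N / log N) := by
    rw [abs_mul, abs_of_nonneg (by positivity : 0 ≤ 1 / log N ^ 2)]
    calc _ ≤ C * (N * log N) * (1 / log N ^ 2) := by
          gcongr
          exact hC N (by omega)
      _ = _ := by field_simp
  have e : ∑ n ∈ Finset.range N, (ArithmeticFunction.vonMangoldt n - 1) =
      U N + S N * (1 / log N ^ 2) := by simp [hU]
  rw [e]
  have := abs_add_le (U N) (S N * (1 / log N ^ 2))
  nlinarith [hind N hN, abs_nonneg (U 8)]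

/-- The prime number theorem for `θ` with error term `O(x / log x)`. -/
lemma exists_abs_theta_sub_self_le : ∃ C : ℝ, 0 ≤ C ∧ ∀ x : ℝ, 8 ≤ x →
    |Chebyshev.theta x - x| ≤ C * (x / log x) := by
  obtain ⟨C, hC0, hC⟩ := exists_abs_sum_vonMangoldt_sub_one_le
  obtain ⟨D, hD⟩ := Chebyshev.psi_sub_theta_le_mul_sqrt
  refine ⟨2 * C + 1 + 2 * |D|, by positivity, fun x hx => ?_⟩
  have hlog : 0 < log x := log_pos (by linarith)
  have h1 : 1 ≤ x / log x := by
    rw [one_le_div (by linarith)]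
    linarith [log_le_sub_one_of_pos (show (0 : ℝ) < x by linarith)]
  have hsqrt : √x ≤ 2 * (x / log x) := by
    have h := log_le_sub_one_of_pos (sqrt_pos.2 (show (0 : ℝ) < x by linarith))
    rw [log_sqrt (by linarith)] at h
    rw [← mul_div_assoc, le_div_iff₀ hlog]
    nlinarith [mul_self_sqrt (show (0 : ℝ) ≤ x by linarith), sqrt_nonneg x]
  have hfl : (⌊x⌋₊ : ℝ) ≤ x := Nat.floor_le (by linarith)
  have hlt : x < ⌊x⌋₊ + 1 := Nat.lt_floor_add_one x
  have h8 : 8 ≤ ⌊x⌋₊ := Nat.le_floor (by exact_mod_cast hx)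
  have hpsi : ∑ n ∈ Finset.range (⌊x⌋₊ + 1), (ArithmeticFunction.vonMangoldt n - 1) =
      Chebyshev.psi x - (⌊x⌋₊ + 1) := by
    rw [Finset.sum_sub_distrib, Chebyshev.psi_eq_sum_Icc, Nat.range_succ_eq_Icc_zero]
    simp
  have hb := hC (⌊x⌋₊ + 1) (by omega)
  rw [hpsi] at hb
  have hb2 : C * (((⌊x⌋₊ + 1 : ℕ) : ℝ) / log (⌊x⌋₊ + 1 : ℕ)) ≤ C * (2 * x / log x) := by
    push_cast
    gcongr
    linarith
  have hD' : D * √x ≤ |D| * (2 * (x / log x)) :=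
    (mul_le_mul_of_nonneg_right (le_abs_self D) (sqrt_nonneg x)).trans
      (mul_le_mul_of_nonneg_left hsqrt (abs_nonneg D))
  have hψθ := hD x
  have hθψ := Chebyshev.theta_le_psi x
  have e : C * (2 * x / log x) = 2 * C * (x / log x) := by ring
  obtain ⟨b1, b2⟩ := abs_le.1 hb
  rw [abs_le]
  constructor <;> nlinarith [abs_nonneg D]

lemma intervalIntegrable_one_div_log_pow (k : ℕ) {a b : ℝ} (ha : 1 < a) (hb : 1 < b) :
    IntervalIntegrable (fun x => 1 / log x ^ k) MeasureTheory.volume a b := by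
  refine ContinuousOn.intervalIntegrable fun x hx => ContinuousAt.continuousWithinAt ?_
  have hx1 : 1 < x := (lt_min ha hb).trans_le hx.1
  have h0 : x ≠ 0 := by linarith
  have h1 : log x ^ k ≠ 0 := pow_ne_zero _ (log_pos hx1).ne'
  fun_prop

lemma integral_one_div_log_pow_le (k : ℕ) {a b : ℝ} (hab : a ≤ b) (ha : 1 < a) :
    ∫ x in a..b, 1 / log x ^ k ≤ (b - a) / log a ^ k := by
  have hlog := log_pos ha
  calc _ ≤ ∫ x in a..b, 1 / log a ^ k := by
        refine intervalIntegral.integral_mono_on hab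
          (intervalIntegrable_one_div_log_pow k ha (ha.trans_le hab)) (by simp) fun x hx => ?_
        have := log_le_log (by linarith) hx.1
        gcongr
    _ = _ := by
        rw [intervalIntegral.integral_const, smul_eq_mul]
        ring

lemma sqrt_mul_log_pow_three_le {x : ℝ} (hx : 1 ≤ x) : √x * log x ^ 3 ≤ 216 * x := by
  have h := log_le_rpow_div (show 0 ≤ x by linarith) (show (0 : ℝ) < 1 / 6 by norm_num)
  have hpow : (x ^ (1 / 6 : ℝ) / (1 / 6)) ^ 3 = 216 * √x := by
    rw [div_pow, ← rpow_natCast, ← rpow_mul (by linarith), sqrt_eq_rpow]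
    norm_num
    ring
  have h3 : log x ^ 3 ≤ 216 * √x := by
    rw [← hpow]
    have := log_nonneg hx
    gcongr
  calc √x * log x ^ 3 ≤ √x * (216 * √x) := by gcongr
    _ = 216 * (√x * √x) := by ring
    _ = 216 * x := by rw [mul_self_sqrt (by linarith)]

lemma exists_integral_one_div_log_pow_three_le : ∃ C : ℝ, 0 ≤ C ∧ ∀ x : ℝ, 4 ≤ x →
    ∫ t in (2 : ℝ)..x, 1 / log t ^ 3 ≤ C * (x / log x ^ 3) := by
  have hlog2 := log_pos one_lt_two
  refine ⟨216 / log 2 ^ 3 + 8, by positivity, fun x hx => ?_⟩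
  have hlog : 0 < log x := log_pos (by linarith)
  have h2 : 2 ≤ √x := le_sqrt_of_sq_le (by norm_num [hx])
  have hsx : √x ≤ x := (sqrt_le_left (by linarith)).2 (by nlinarith)
  rw [← intervalIntegral.integral_add_adjacent_intervals (b := √x)
    (intervalIntegrable_one_div_log_pow 3 one_lt_two (by linarith))
    (intervalIntegrable_one_div_log_pow 3 (by linarith) (by linarith))]
  have a1 := integral_one_div_log_pow_le 3 h2 one_lt_two
  have a2 := integral_one_div_log_pow_le 3 hsx (by linarith)
  have b1 : (√x - 2) / log 2 ^ 3 ≤ 216 / log 2 ^ 3 * (x / log x ^ 3) := by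
    have : √x ≤ 216 * x / log x ^ 3 := by
      rw [le_div_iff₀ (by positivity)]
      exact sqrt_mul_log_pow_three_le (by linarith)
    calc (√x - 2) / log 2 ^ 3 ≤ (216 * x / log x ^ 3) / log 2 ^ 3 := by
          gcongr
          linarith
      _ = _ := by ring
  have b2 : (x - √x) / log √x ^ 3 ≤ 8 * (x / log x ^ 3) := by
    rw [log_sqrt (by linarith)]
    calc (x - √x) / (log x / 2) ^ 3 ≤ x / (log x / 2) ^ 3 := by
          gcongr
          linarith [sqrt_nonneg x]
      _ = _ := by field_simp; ring
  linarith

lemma integral_one_div_log_sq_eq {x : ℝ} (hx : 2 ≤ x) :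
    ∫ t in (2 : ℝ)..x, 1 / log t ^ 2 =
      x / log x ^ 2 - 2 / log 2 ^ 2 + 2 * ∫ t in (2 : ℝ)..x, 1 / log t ^ 3 := by
  have i2 := intervalIntegrable_one_div_log_pow 2 one_lt_two (show 1 < x by linarith)
  have i3 := (intervalIntegrable_one_div_log_pow 3 one_lt_two (show 1 < x by linarith)).const_mul 2
  have h := intervalIntegral.integral_eq_sub_of_hasDerivAt (a := 2) (b := x)
    (f := fun t => t / log t ^ 2) (f' := fun t => 1 / log t ^ 2 - 2 * (1 / log t ^ 3))
    (fun t ht => ?_) (i2.sub i3)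
  · rw [intervalIntegral.integral_sub i2 i3, intervalIntegral.integral_const_mul] at h
    linarith
  · rw [Set.uIcc_of_le hx] at ht
    have ht0 : t ≠ 0 := by linarith [ht.1]
    have hlog : log t ≠ 0 := (log_pos (by linarith [ht.1])).ne'
    refine ((hasDerivAt_id t).div ((hasDerivAt_log ht0).pow 2) (pow_ne_zero 2 hlog)).congr_deriv ?_
    simp only [id, Pi.pow_apply]
    field_simp
    push_cast
    ring

lemma exists_abs_theta_sub_self_le_of_two_le : ∃ C : ℝ, 0 ≤ C ∧ ∀ x : ℝ, 2 ≤ x →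
    |Chebyshev.theta x - x| ≤ C * (x / log x) := by
  obtain ⟨C, hC0, hC⟩ := exists_abs_theta_sub_self_le
  refine ⟨C + 9, by positivity, fun x hx => ?_⟩
  have hlog : 0 < log x := log_pos (by linarith)
  have hpos : 0 < x / log x := by positivity
  rcases le_or_gt 8 x with h | h
  · exact (hC x h).trans (by nlinarith)
  · have h8 : log x ≤ 3 := by
      have h2 := log_le_log (by linarith) h.le
      have h3 : log 8 = 3 * log 2 := by
        rw [show (8 : ℝ) = 2 ^ 3 by norm_num, log_pow]; norm_num
      linarith [log_two_lt_d9]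
    have hxle : x ≤ 3 * (x / log x) := by
      rw [← mul_div_assoc, le_div_iff₀ hlog]
      nlinarith
    have h1 := Chebyshev.theta_nonneg x
    have h2 := Chebyshev.theta_le_log4_mul_x (show 0 ≤ x by linarith)
    have h4 : log 4 = 2 * log 2 := by
      rw [show (4 : ℝ) = 2 ^ 2 by norm_num, log_pow]; norm_num
    have h5 : Chebyshev.theta x ≤ 2 * x := by
      rw [h4] at h2
      nlinarith [log_two_lt_d9]
    have h6 : 0 ≤ C * (x / log x) := by positivity
    rw [abs_le]
    constructor <;> nlinarith

/-- Asymptotics for the difference `π(x) - θ(x) / log x`. -/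
lemma exists_abs_integral_theta_sub_le : ∃ C : ℝ, 0 ≤ C ∧ ∀ x : ℝ, 4 ≤ x →
    |(∫ t in (2 : ℝ)..x, Chebyshev.theta t / (t * log t ^ 2)) - x / log x ^ 2| ≤
      C * (x / log x ^ 3) := by
  obtain ⟨C, hC0, hC⟩ := exists_abs_theta_sub_self_le_of_two_le
  obtain ⟨D, hD0, hD⟩ := exists_integral_one_div_log_pow_three_le
  have hlog2 := log_pos one_lt_two
  refine ⟨C * D + 2 * D + 2 / log 2 ^ 2 * 216, by positivity, fun x hx => ?_⟩
  have hlog : 0 < log x := log_pos (by linarith)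
  have hI := hD x hx
  have i1 : IntervalIntegrable (fun t => Chebyshev.theta t / (t * log t ^ 2))
      MeasureTheory.volume 2 x := by
    rw [intervalIntegrable_iff, Set.uIoc_of_le (by linarith),
      ← integrableOn_Icc_iff_integrableOn_Ioc]
    exact Chebyshev.integrableOn_theta_div_id_mul_log_sq x
  have i2 := intervalIntegrable_one_div_log_pow 2 one_lt_two (show 1 < x by linarith)
  have i3 := intervalIntegrable_one_div_log_pow 3 one_lt_two (show 1 < x by linarith)
  have hdiff : |(∫ t in (2 : ℝ)..x, Chebyshev.theta t / (t * log t ^ 2)) -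
      ∫ t in (2 : ℝ)..x, 1 / log t ^ 2| ≤ C * ∫ t in (2 : ℝ)..x, 1 / log t ^ 3 := by
    rw [← intervalIntegral.integral_sub i1 i2, ← intervalIntegral.integral_const_mul]
    refine (intervalIntegral.abs_integral_le_integral_abs (by linarith)).trans ?_
    refine intervalIntegral.integral_mono_on (by linarith) (i1.sub i2).abs (i3.const_mul C)
      fun t ht => ?_
    have ht0 : 0 < t := by linarith [ht.1]
    have htl : 0 < log t := log_pos (by linarith [ht.1])
    have e : Chebyshev.theta t / (t * log t ^ 2) - 1 / log t ^ 2 =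
        (Chebyshev.theta t - t) / (t * log t ^ 2) := by
      field_simp
    rw [e, abs_div, abs_of_pos (by positivity : 0 < t * log t ^ 2),
      div_le_iff₀ (by positivity)]
    refine (hC t ht.1).trans (le_of_eq ?_)
    field_simp
  rw [integral_one_div_log_sq_eq (by linarith)] at hdiff
  have hI0 : 0 ≤ ∫ t in (2 : ℝ)..x, 1 / log t ^ 3 :=
    intervalIntegral.integral_nonneg (by linarith) fun t ht => by
      have := log_nonneg (show 1 ≤ t by linarith [ht.1])
      positivity
  have hone : 1 ≤ 216 * (x / log x ^ 3) := by
    rw [← mul_div_assoc, one_le_div (by positivity)]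
    have h1 : 1 ≤ √x := one_le_sqrt.2 (by linarith)
    have := sqrt_mul_log_pow_three_le (show 1 ≤ x by linarith)
    nlinarith [pow_pos hlog 3]
  have hc : 2 / log 2 ^ 2 ≤ 2 / log 2 ^ 2 * (216 * (x / log x ^ 3)) :=
    le_mul_of_one_le_right (by positivity) hone
  have hc0 : 0 ≤ 2 / log 2 ^ 2 := by positivity
  have hCI := mul_le_mul_of_nonneg_left hI hC0
  obtain ⟨d1, d2⟩ := abs_le.1 hdiff
  rw [abs_le]
  constructor <;> nlinarith

lemma exists_abs_primeCounting_sub_le : ∃ C : ℝ, 0 ≤ C ∧ ∀ x : ℝ, 8 ≤ x →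
    |(Nat.primeCounting ⌊x⌋₊ : ℝ) - x / log x| ≤ C * (x / log x ^ 2) := by
  obtain ⟨C, hC0, hC⟩ := exists_abs_theta_sub_self_le
  obtain ⟨D, hD0, hD⟩ := exists_abs_integral_theta_sub_le
  refine ⟨C + D + 1, by positivity, fun x hx => ?_⟩
  have hlog : 1 ≤ log x := by
    rw [le_log_iff_exp_le (by linarith)]
    linarith [exp_one_lt_d9]
  have hlog0 : 0 < log x := by linarith
  have h1 := hC x hx
  have h2 := hD x (by linarith)
  have h3 : D * (x / log x ^ 3) ≤ D * (x / log x ^ 2) := by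
    gcongr
    norm_num
  have h4 : |Chebyshev.theta x / log x - x / log x| ≤ C * (x / log x ^ 2) := by
    rw [← sub_div, abs_div, abs_of_pos hlog0, div_le_iff₀ hlog0]
    refine h1.trans (le_of_eq ?_)
    field_simp
  rw [Chebyshev.primeCounting_eq_theta_div_log_add_integral (by linarith)]
  obtain ⟨d1, d2⟩ := abs_le.1 h2
  obtain ⟨e1, e2⟩ := abs_le.1 h4
  have : 0 ≤ x / log x ^ 2 := by positivity
  rw [abs_le]
  constructor <;> nlinarith

lemma tendsto_primeCounting_mul_log_div :
    Filter.Tendsto (fun x : ℝ => (Nat.primeCounting ⌊x⌋₊ : ℝ) * log x / x) Filter.atTop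
      (nhds 1) := by
  obtain ⟨C, hC0, hC⟩ := exists_abs_primeCounting_sub_le
  rw [tendsto_iff_norm_sub_tendsto_zero]
  refine squeeze_zero' (Filter.Eventually.of_forall fun _ => norm_nonneg _) ?_
    (tendsto_log_atTop.const_div_atTop C)
  filter_upwards [Filter.eventually_ge_atTop 8] with x hx
  have hlog : 0 < log x := log_pos (by linarith)
  have hx0 : 0 < x := by linarith
  have e : (Nat.primeCounting ⌊x⌋₊ : ℝ) * log x / x - 1 =
      (Nat.primeCounting ⌊x⌋₊ - x / log x) * (log x / x) := by
    field_simp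
  rw [e, norm_mul, norm_eq_abs, norm_of_nonneg (by positivity)]
  calc _ ≤ C * (x / log x ^ 2) * (log x / x) := by
        gcongr
        exact hC x hx
    _ = C / log x := by field_simp

lemma tendsto_log_primeCounting_add_log_log_sub_log :
    Filter.Tendsto (fun x : ℝ => log (Nat.primeCounting ⌊x⌋₊) + log (log x) - log x)
      Filter.atTop (nhds 0) := by
  have h := tendsto_primeCounting_mul_log_div.log one_ne_zero
  rw [log_one] at h
  refine h.congr' ?_
  filter_upwards [Filter.eventually_ge_atTop 8] with x hx
  have hlog : 0 < log x := log_pos (by linarith)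
  have hπ : (Nat.primeCounting ⌊x⌋₊ : ℝ) ≠ 0 := by
    rw [Nat.cast_ne_zero, Ne, Nat.primeCounting_eq_zero_iff, not_le]
    exact Nat.lt_of_lt_of_le one_lt_two (Nat.le_floor (by push_cast; linarith))
  rw [log_div (mul_ne_zero hπ hlog.ne') (by linarith), log_mul hπ hlog.ne']

lemma exists_eventually_abs_one_sub_mul_log_le : ∃ C : ℝ, ∀ᶠ x : ℝ in Filter.atTop,
    |1 - (Nat.primeCounting ⌊x⌋₊ * log x - Chebyshev.theta x) / Nat.primeCounting ⌊x⌋₊| *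
      log x ≤ C := by
  obtain ⟨C, hC0, hC⟩ := exists_abs_primeCounting_sub_le
  obtain ⟨D, hD0, hD⟩ := exists_abs_integral_theta_sub_le
  refine ⟨2 * (C + D), ?_⟩
  filter_upwards [Filter.eventually_ge_atTop 8, tendsto_log_atTop.eventually_ge_atTop (2 * C)]
    with x hx hxC
  have hlog : 0 < log x := log_pos (by linarith)
  have hx0 : 0 < x := by linarith
  set n : ℝ := (Nat.primeCounting ⌊x⌋₊ : ℝ) with hn
  set K : ℝ := ∫ t in (2 : ℝ)..x, Chebyshev.theta t / (t * log t ^ 2) with hK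
  have hnK : n * log x - Chebyshev.theta x = log x * K := by
    rw [hn, Chebyshev.primeCounting_eq_theta_div_log_add_integral (by linarith)]
    field_simp
    ring
  have hlow : x / (2 * log x) ≤ n := by
    have h1 := (abs_le.1 (hC x hx)).1
    have h2 : C * (x / log x ^ 2) ≤ x / (2 * log x) := by
      rw [← mul_div_assoc, div_le_div_iff₀ (by positivity) (by positivity)]
      have : 0 ≤ x * log x := by positivity
      nlinarith
    have h3 : x / log x = x / (2 * log x) + x / (2 * log x) := by field_simp; ring
    linarith
  have hn0 : 0 < n := lt_of_lt_of_le (by positivity) hlow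
  have e : 1 - log x * K / n = ((n - x / log x) - log x * (K - x / log x ^ 2)) / n := by
    field_simp
    ring
  have hnum : |(n - x / log x) - log x * (K - x / log x ^ 2)| ≤ (C + D) * (x / log x ^ 2) := by
    refine (abs_sub _ _).trans ?_
    rw [abs_mul, abs_of_pos hlog]
    have h1 := hC x hx
    have h2 := mul_le_mul_of_nonneg_left (hD x (by linarith)) hlog.le
    have h3 : log x * (D * (x / log x ^ 3)) = D * (x / log x ^ 2) := by field_simp
    linarith
  rw [hnK, e, abs_div, abs_of_pos hn0, div_mul_eq_mul_div, div_le_iff₀ hn0]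
  calc _ ≤ (C + D) * (x / log x ^ 2) * log x := by gcongr
    _ = 2 * (C + D) * (x / (2 * log x)) := by field_simp
    _ ≤ _ := by gcongr

lemma chebyshevTheta_eq (m : ℕ) : chebyshevTheta m = Chebyshev.theta m := by
  rw [Chebyshev.theta_eq_sum_Icc, chebyshevTheta, Nat.floor_natCast, Nat.range_succ_eq_Icc_zero]

lemma primeCounting_nthPrime {n : ℕ} (hn : 1 ≤ n) : Nat.primeCounting (nthPrime n) = n := by
  rw [Nat.primeCounting, Nat.primeCounting', nthPrime,
    Nat.count_nth_succ_of_infinite Nat.infinite_setOfPred_prime]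
  omega

lemma prime_nthPrime (n : ℕ) : (nthPrime n).Prime := Nat.prime_nth_prime _

lemma nthPrime_lt_nthPrime_succ {n : ℕ} (hn : 1 ≤ n) : nthPrime n < nthPrime (n + 1) :=
  Nat.nth_strictMono Nat.infinite_setOfPred_prime (by omega)

lemma le_nthPrime_of_lt_nthPrime_succ {n q : ℕ} (hn : 1 ≤ n) (hq : q.Prime)
    (h : q < nthPrime (n + 1)) : q ≤ nthPrime n := by
  refine Nat.le_nth_of_lt_nth_succ ?_ hq
  rwa [Nat.sub_add_cancel hn]

lemma le_nthPrime (n : ℕ) : n ≤ nthPrime n := by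
  have := Nat.add_two_le_nth_prime (n - 1)
  rw [nthPrime]
  omega

lemma chebyshevTheta_nthPrime_succ {n : ℕ} (hn : 1 ≤ n) :
    chebyshevTheta (nthPrime (n + 1)) = chebyshevTheta (nthPrime n) + log (nthPrime (n + 1)) := by
  have hlt := nthPrime_lt_nthPrime_succ hn
  have e : (Finset.range (nthPrime (n + 1) + 1)).filter Nat.Prime =
      insert (nthPrime (n + 1)) ((Finset.range (nthPrime n + 1)).filter Nat.Prime) := by
    ext q
    simp only [Finset.mem_filter, Finset.mem_range, Finset.mem_insert]
    constructor
    · rintro ⟨h1, h2⟩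
      rcases (Nat.lt_succ_iff.1 h1).eq_or_lt with h | h
      · exact Or.inl h
      · exact Or.inr ⟨Nat.lt_succ_iff.2 (le_nthPrime_of_lt_nthPrime_succ hn h2 h), h2⟩
    · rintro (rfl | ⟨h1, h2⟩)
      · exact ⟨Nat.lt_succ_self _, prime_nthPrime _⟩
      · exact ⟨by omega, h2⟩
  rw [chebyshevTheta, e, Finset.sum_insert (by simp; omega), chebyshevTheta, add_comm]

lemma nthPrime_succ_le_two_mul {n : ℕ} (hn : 1 ≤ n) :
    nthPrime (n + 1) ≤ 2 * nthPrime n := by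
  obtain ⟨q, hq, h1, h2⟩ := Nat.exists_prime_lt_and_le_two_mul (nthPrime n)
    (prime_nthPrime n).ne_zero
  by_contra! h
  exact (le_nthPrime_of_lt_nthPrime_succ hn hq (h2.trans_lt h)).not_gt h1

lemma exists_log_nthPrime_succ_sub_mul_log_le : ∃ C : ℝ, ∀ n : ℕ, 8 ≤ n →
    |log (nthPrime (n + 1)) - log (nthPrime n)| * log (nthPrime n) ≤ C := by
  obtain ⟨C, hC0, hC⟩ := exists_abs_theta_sub_self_le
  refine ⟨3 * C + 8, fun n hn => ?_⟩
  have hn1 : 1 ≤ n := by omega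
  have hx8 : (8 : ℝ) ≤ (nthPrime n : ℝ) := by exact_mod_cast hn.trans (le_nthPrime n)
  have hxy : (nthPrime n : ℝ) ≤ (nthPrime (n + 1) : ℝ) := by
    exact_mod_cast (nthPrime_lt_nthPrime_succ hn1).le
  have hy2 : (nthPrime (n + 1) : ℝ) ≤ 2 * (nthPrime n : ℝ) := by
    exact_mod_cast nthPrime_succ_le_two_mul hn1
  have hθ := chebyshevTheta_nthPrime_succ hn1
  rw [chebyshevTheta_eq, chebyshevTheta_eq] at hθ
  set x : ℝ := (nthPrime n : ℝ) with hx
  set y : ℝ := (nthPrime (n + 1) : ℝ) with hy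
  have hlog : 0 < log x := log_pos (by linarith)
  have hlogxy : log x ≤ log y := log_le_log (by linarith) hxy
  have h1 := abs_le.1 (hC x hx8)
  have h2 := abs_le.1 (hC y (by linarith))
  have h3 : C * (y / log y) ≤ C * (2 * x / log x) := by gcongr
  have h4 : log y ≤ 8 * (x / log x) := by
    have h5 : log y ≤ 2 * log x := by
      have : log (x * x) = 2 * log x := by rw [log_mul (by linarith) (by linarith)]; ring
      rw [← this]
      exact log_le_log (by linarith) (by nlinarith)
    have h6 := log_le_sub_one_of_pos (sqrt_pos.2 (show (0 : ℝ) < x by linarith))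
    rw [log_sqrt (by linarith)] at h6
    have h7 : log x ^ 2 ≤ 4 * x := by
      calc log x ^ 2 ≤ (2 * √x) ^ 2 := by
            gcongr
            linarith
        _ = 4 * x := by rw [mul_pow, sq_sqrt (by linarith)]; norm_num
    rw [← mul_div_assoc, le_div_iff₀ hlog]
    nlinarith
  have hgap : y - x ≤ (3 * C + 8) * (x / log x) := by
    have e : C * (2 * x / log x) = 2 * C * (x / log x) := by ring
    nlinarith [h1.1, h1.2, h2.1, h2.2]
  have hdiv : log y - log x ≤ (y - x) / x := by
    rw [← log_div (by linarith) (by linarith)]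
    have := log_le_sub_one_of_pos (show 0 < y / x by
      have : 0 < y := by linarith
      positivity)
    rwa [sub_div, div_self (by linarith)]
  rw [abs_of_nonneg (by linarith)]
  calc (log y - log x) * log x ≤ (y - x) / x * log x := by gcongr
    _ ≤ (3 * C + 8) * (x / log x) / x * log x := by gcongr
    _ = 3 * C + 8 := by field_simp

open Filter Topology in
/-- The asymptotic analysis behind the expansion of `θ(p_n) / n`: here `l`, `L` and `m` stand for
`log p_n`, `log p_{n+1}` and `log n`, and `l - J` for `θ(p_n) / n`. -/
lemma tendsto_of_log_asymptotics {l L m J : ℕ → ℝ} (hl : Tendsto l atTop atTop)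
    (hm : Tendsto (fun n => m n + log (l n) - l n) atTop (𝓝 0)) {C D : ℝ}
    (hL : ∀ᶠ n in atTop, |L n - l n| * l n ≤ C) (hJ : ∀ᶠ n in atTop, |1 - J n| * l n ≤ D) :
    Tendsto (fun n => ((l n - J n) / L n - 1 + 1 / m n) * m n ^ 2 / log (m n)) atTop (𝓝 1) := by
  have hloglog : Tendsto (fun n => log (l n) / l n) atTop (𝓝 0) :=
    isLittleO_log_id_atTop.tendsto_div_nhds_zero.comp hl
  have hinv : Tendsto (fun n => (l n)⁻¹) atTop (𝓝 0) := tendsto_inv_atTop_zero.comp hl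
  have hml : Tendsto (fun n => m n / l n) atTop (𝓝 1) := by
    have h := ((hm.mul hinv).sub hloglog).add_const 1
    simp only [mul_zero, sub_zero, zero_add] at h
    refine h.congr' ?_
    filter_upwards [hl.eventually_gt_atTop 0] with n hn
    field_simp
    ring
  have hm' : Tendsto m atTop atTop := by
    refine (hml.pos_mul_atTop one_pos hl).congr' ?_
    filter_upwards [hl.eventually_gt_atTop 0] with n hn
    field_simp
  have hlogm : Tendsto (fun n => log (m n)) atTop atTop := tendsto_log_atTop.comp hm'
  have hlogm' : Tendsto (fun n => (log (m n))⁻¹) atTop (𝓝 0) := tendsto_inv_atTop_zero.comp hlogm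
  have hlogdiff : Tendsto (fun n => log (m n) - log (l n)) atTop (𝓝 0) := by
    have h := hml.log one_ne_zero
    rw [log_one] at h
    refine h.congr' ?_
    filter_upwards [hl.eventually_gt_atTop 0, hm'.eventually_gt_atTop 0] with n h1 h2
    rw [log_div h2.ne' h1.ne']
  have hLl : Tendsto (fun n => L n - l n) atTop (𝓝 0) := by
    refine (bdd_le_mul_tendsto_zero' C (f := fun n => (L n - l n) * l n) ?_ hinv).congr' ?_
    · filter_upwards [hL, hl.eventually_gt_atTop 0] with n h1 h2
      rwa [abs_mul, abs_of_pos h2]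
    · filter_upwards [hl.eventually_gt_atTop 0] with n hn
      field_simp
  have hLl' : Tendsto (fun n => L n / l n) atTop (𝓝 1) := by
    have h := (hLl.mul hinv).add_const 1
    simp only [mul_zero, zero_add] at h
    refine h.congr' ?_
    filter_upwards [hl.eventually_gt_atTop 0] with n hn
    field_simp
    ring
  have hmL : Tendsto (fun n => m n / L n) atTop (𝓝 1) := by
    have h := hml.div hLl' one_ne_zero
    rw [div_one] at h
    refine h.congr' ?_
    filter_upwards [hl.eventually_gt_atTop 0] with n hn
    exact div_div_div_cancel_right₀ hn.ne' _ _
  have hA : Tendsto (fun n => (L n - m n) / log (m n)) atTop (𝓝 1) := by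
    have h := (((hLl.sub hm).sub hlogdiff).mul hlogm').add_const 1
    simp only [sub_zero, mul_zero, zero_add] at h
    refine h.congr' ?_
    filter_upwards [hlogm.eventually_gt_atTop 0] with n hn
    field_simp
    ring
  have hsmall : Tendsto (fun n => m n / l n * (log (m n))⁻¹) atTop (𝓝 0) := by
    simpa using hml.mul hlogm'
  have hbdd : ∀ {u : ℕ → ℝ} {E : ℝ}, (∀ᶠ n in atTop, |u n| * l n ≤ E) →
      Tendsto (fun n => u n * m n / log (m n)) atTop (𝓝 0) := by
    intro u E hu
    refine (bdd_le_mul_tendsto_zero' E (f := fun n => u n * l n) ?_ hsmall).congr' ?_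
    · filter_upwards [hu, hl.eventually_gt_atTop 0] with n h1 h2
      rwa [abs_mul, abs_of_pos h2]
    · filter_upwards [hl.eventually_gt_atTop 0] with n hn
      field_simp
  have h := ((hA.add (hbdd hJ)).sub (hbdd hL)).mul hmL
  simp only [add_zero, sub_zero, mul_one] at h
  refine h.congr' ?_
  filter_upwards [hlogm.eventually_gt_atTop 0, hm'.eventually_gt_atTop 0,
    hl.eventually_gt_atTop 0, hLl'.eventually_ne one_ne_zero] with n h1 h2 h3 h4
  have hLn : L n ≠ 0 := fun h0 => h4 (by simp [h0])
  field_simp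
  ring

theorem theta_asymptotic :
    Filter.Tendsto (fun n : ℕ =>
        (chebyshevTheta (nthPrime n) / ((n : ℝ) * Real.log (nthPrime (n + 1)))
          - 1 + 1 / Real.log n) * (Real.log n) ^ 2 / Real.log (Real.log n))
      Filter.atTop (nhds 1) := by
  have hp : Filter.Tendsto (fun n => (nthPrime n : ℝ)) Filter.atTop Filter.atTop :=
    tendsto_natCast_atTop_atTop.comp
      (Filter.tendsto_atTop_mono le_nthPrime Filter.tendsto_id)
  obtain ⟨C, hC⟩ := exists_log_nthPrime_succ_sub_mul_log_le
  obtain ⟨D, hD⟩ := exists_eventually_abs_one_sub_mul_log_le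
  have hm := tendsto_log_primeCounting_add_log_log_sub_log.comp hp
  have hJ := hp.eventually hD
  refine (tendsto_of_log_asymptotics (l := fun n => log (nthPrime n))
    (L := fun n => log (nthPrime (n + 1))) (m := fun n => log n)
    (J := fun n => (n * log (nthPrime n) - chebyshevTheta (nthPrime n)) / n)
    (C := C) (D := D) (tendsto_log_atTop.comp hp) ?_ ?_ ?_).congr' ?_
  · refine hm.congr' ?_
    filter_upwards [Filter.eventually_ge_atTop 1] with n hn
    simp [primeCounting_nthPrime hn]
  · filter_upwards [Filter.eventually_ge_atTop 8] with n hn using hC n hn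
  · filter_upwards [hJ, Filter.eventually_ge_atTop 1] with n h hn
    rw [Nat.floor_natCast, primeCounting_nthPrime hn, ← chebyshevTheta_eq] at h
    exact h
  · filter_upwards [Filter.eventually_ge_atTop 1] with n hn
    have hn0 : (n : ℝ) ≠ 0 := by
      rw [Nat.cast_ne_zero]
      omega
    have e : log (nthPrime n) - (n * log (nthPrime n) - chebyshevTheta (nthPrime n)) / n =
        chebyshevTheta (nthPrime n) / n := by
      field_simp
      ring
    simp only [e, div_div]
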